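/- arXiv:0905.3926 — 2 statements merged into one kernel-verified Lean document; each statement's English description precedes it below -/
import Mathlib

section
/- In the setting of the abstract operator S below, assume Hypothesis 1 and Hypothesis 2 hold, and let u, v be real numbers with r ≤ u < v ≤ s. Then there exists a constant C such that for all finite subsets J, K ⊂ ℤ, every family (E_j)_{j∈J} of pairwise disjoint Borel subsets of ℝⁿ of positive finite measure, and every family (F_k)_{k∈K} of pairwise disjoint Borel subsets of ℝⁿ of positive finite measure, ∑_{j∈J} ∑_{k∈K} 2^{j} 2^{k} 𝒮(E_j, F_k) ≤ C · (∑_{j∈J} 2^{ju} |E_j|^{u/r})^{1/u} · (∑_{k∈K} 2^{kv′} |F_k|^{v′/s′})^{1/v′}, where v′ = v/(v−1). (This is the statement that S extends to a bounded operator from L^{r,u}(ℝⁿ) to L^{s,v}(ℝⁿ), expressed in bilinear discretized form.) -/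
open MeasureTheory Set
open scoped ENNReal

/-- The bilinear form `𝒮(E,F) = ∫_F S(1_E)(x) dx` of an abstract positive operator `S`,
where `S E` plays the role of `S(1_E)`. -/
noncomputable def calS (n : ℕ)
    (S : Set (EuclideanSpace ℝ (Fin n)) → EuclideanSpace ℝ (Fin n) → ℝ≥0∞)
    (E F : Set (EuclideanSpace ℝ (Fin n))) : ℝ≥0∞ :=
  ∫⁻ x in F, S E x

/-- Hypothesis 1: there are a finite set `U ⊂ ℝ⁴` of exponent quadruples `(u₁,u₂,u₃,u₄)`
with `u₁+u₂ = r'/(r'-s')`, `u₃+u₄ = r/(s-r)` and `u₂/r - u₄/r' - 1 > 0`, and a constant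
`C₁`, such that whenever `S(1_{E_j}) ≥ α_j` on `F` and `𝒮(E_j,F) ≥ β_j |E_j|` for `j=1,2`
with `α₁ ≤ α₂` and `β₂ ≤ β₁`, some quadruple satisfies
`α₁^{u₁} α₂^{u₂} β₁^{u₃} β₂^{u₄} ≤ C₁ |E₂|`. -/
def Hyp1 (n : ℕ) (r s : ℝ)
    (S : Set (EuclideanSpace ℝ (Fin n)) → EuclideanSpace ℝ (Fin n) → ℝ≥0∞) : Prop :=
  ∃ (U : Finset (ℝ × ℝ × ℝ × ℝ)) (C₁ : ℝ), 0 < C₁ ∧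
    (∀ u ∈ U,
      u.1 + u.2.1 = (r / (r - 1)) / (r / (r - 1) - s / (s - 1)) ∧
      u.2.2.1 + u.2.2.2 = r / (s - r) ∧
      u.2.1 / r - u.2.2.2 / (r / (r - 1)) - 1 > 0) ∧
    ∀ E₁ E₂ F : Set (EuclideanSpace ℝ (Fin n)),
      MeasurableSet E₁ → MeasurableSet E₂ → MeasurableSet F →
      0 < volume E₁ → volume E₁ < ∞ → 0 < volume E₂ → volume E₂ < ∞ →
      0 < volume F → volume F < ∞ →
      ∀ α₁ α₂ β₁ β₂ : ℝ, 0 < α₁ → α₁ ≤ α₂ → 0 < β₂ → β₂ ≤ β₁ →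
      (∀ x ∈ F, ENNReal.ofReal α₁ ≤ S E₁ x) →
      (∀ x ∈ F, ENNReal.ofReal α₂ ≤ S E₂ x) →
      ENNReal.ofReal β₁ * volume E₁ ≤ calS n S E₁ F →
      ENNReal.ofReal β₂ * volume E₂ ≤ calS n S E₂ F →
      ∃ u ∈ U, ENNReal.ofReal (α₁ ^ u.1 * α₂ ^ u.2.1 * β₁ ^ u.2.2.1 * β₂ ^ u.2.2.2) ≤
        ENNReal.ofReal C₁ * volume E₂

/-- Hypothesis 2: there are a finite set `V ⊂ ℝ⁴` of exponent quadruples `(v₁,v₂,v₃,v₄)`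
with `v₁+v₂ = s'/(r'-s')`, `v₃+v₄ = s/(s-r)` and `v₄/s' - v₂/s - 1 > 0`, and a constant
`C₂`, such that whenever `S*(1_{F_j}) ≥ β_j` on `E` and `𝒮(E,F_j) ≥ α_j |F_j|` for `j=1,2`
with `α₂ ≤ α₁` and `β₁ ≤ β₂`, some quadruple satisfies
`α₁^{v₁} α₂^{v₂} β₁^{v₃} β₂^{v₄} ≤ C₂ |F₂|`. -/
def Hyp2 (n : ℕ) (r s : ℝ)
    (S Sstar : Set (EuclideanSpace ℝ (Fin n)) → EuclideanSpace ℝ (Fin n) → ℝ≥0∞) : Prop :=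
  ∃ (V : Finset (ℝ × ℝ × ℝ × ℝ)) (C₂ : ℝ), 0 < C₂ ∧
    (∀ v ∈ V,
      v.1 + v.2.1 = (s / (s - 1)) / (r / (r - 1) - s / (s - 1)) ∧
      v.2.2.1 + v.2.2.2 = s / (s - r) ∧
      v.2.2.2 / (s / (s - 1)) - v.2.1 / s - 1 > 0) ∧
    ∀ E F₁ F₂ : Set (EuclideanSpace ℝ (Fin n)),
      MeasurableSet E → MeasurableSet F₁ → MeasurableSet F₂ →
      0 < volume E → volume E < ∞ → 0 < volume F₁ → volume F₁ < ∞ →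
      0 < volume F₂ → volume F₂ < ∞ →
      ∀ α₁ α₂ β₁ β₂ : ℝ, 0 < α₂ → α₂ ≤ α₁ → 0 < β₁ → β₁ ≤ β₂ →
      (∀ x ∈ E, ENNReal.ofReal β₁ ≤ Sstar F₁ x) →
      (∀ x ∈ E, ENNReal.ofReal β₂ ≤ Sstar F₂ x) →
      ENNReal.ofReal α₁ * volume F₁ ≤ calS n S E F₁ →
      ENNReal.ofReal α₂ * volume F₂ ≤ calS n S E F₂ →
      ∃ v ∈ V, ENNReal.ofReal (α₁ ^ v.1 * α₂ ^ v.2.1 * β₁ ^ v.2.2.1 * β₂ ^ v.2.2.2) ≤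
        ENNReal.ofReal C₂ * volume F₂

/-- Measurable sets of positive finite measure. -/
structure PosFinite {X : Type*} [MeasurableSpace X] (μ : Measure X) (E : Set X) : Prop where
  measurableSet : MeasurableSet E
  pos : 0 < μ E
  lt_top : μ E < ∞

lemma PosFinite.real_pos {X : Type*} [MeasurableSpace X] {μ : Measure X} {E : Set X}
    (h : PosFinite μ E) : 0 < μ.real E :=
  ENNReal.toReal_pos h.pos.ne' h.lt_top.ne

lemma PosFinite.of_subset_of_le {X : Type*} [MeasurableSpace X] {μ : Measure X} {E G : Set X}
    {c : ℝ} (h : PosFinite μ E) (hG : MeasurableSet G) (hGE : G ⊆ E) (hc : 0 < c)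
    (hle : c ≤ μ.real G) : PosFinite μ G :=
  ⟨hG, pos_iff_ne_zero.2 fun h0 => by simp [measureReal_def, h0] at hle; linarith,
    (measure_mono hGE).trans_lt h.lt_top⟩

/-- A pairwise overlap bound for subsets of a finite measure set controls their total measure. -/
lemma sum_measureReal_le_of_overlap {X ι : Type*} [MeasurableSpace X] {μ : Measure X} {F : Set X}
    (hF : PosFinite μ F) {I : Finset ι} {G : ι → Set X} (hG : ∀ i ∈ I, MeasurableSet (G i))
    (hGF : ∀ i ∈ I, G i ⊆ F) {c N : ℝ} (hc : 0 < c) (hN0 : 0 ≤ N)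
    (hcG : ∀ i ∈ I, c * μ.real F ≤ μ.real (G i))
    (hN : ∀ i ∈ I, ∀ I' ⊆ I, (∀ j ∈ I', c ^ 2 / 2 * μ.real F ≤ μ.real (G i ∩ G j)) →
      (I'.card : ℝ) ≤ N) :
    ∑ i ∈ I, μ.real (G i) ≤ 2 * N * μ.real F := by
  classical
  have hm := hF.real_pos
  set m := μ.real F with hm_def
  set S := ∑ i ∈ I, μ.real (G i) with hS
  have hfin : ∀ A ⊆ F, μ A ≠ ∞ := fun A hA => ((measure_mono hA).trans_lt hF.lt_top).ne
  have hCS : S ^ 2 ≤ m * ∑ i ∈ I, ∑ j ∈ I, μ.real (G i ∩ G j) := by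
    set f : X → ℝ := fun x => ∑ i ∈ I, (G i).indicator (fun _ => (1 : ℝ)) x with hf
    have hint : ∀ A ⊆ F, MeasurableSet A →
        Integrable (A.indicator fun _ => (1 : ℝ)) (μ.restrict F) := fun A hA hAm =>
      (integrable_indicator_iff hAm).2 (integrableOn_const (by
        rw [Measure.restrict_apply hAm]; exact hfin _ inter_subset_right))
    have hval : ∀ A ⊆ F, MeasurableSet A →
        ∫ x in F, A.indicator (fun _ => (1 : ℝ)) x ∂μ = μ.real A := fun A hA hAm => by
      rw [integral_indicator hAm, setIntegral_const, smul_eq_mul, mul_one,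
        measureReal_restrict_apply hAm, inter_eq_left.2 hA]
    have hfint : Integrable f (μ.restrict F) :=
      integrable_finsetSum _ fun i hi => hint _ (hGF i hi) (hG i hi)
    have hf2 : ∀ x, f x ^ 2 = ∑ i ∈ I, ∑ j ∈ I, (G i ∩ G j).indicator (fun _ => (1 : ℝ)) x := by
      intro x
      rw [sq, hf, Finset.sum_mul_sum]
      refine Finset.sum_congr rfl fun i _ => Finset.sum_congr rfl fun j _ => ?_
      by_cases h1 : x ∈ G i <;> by_cases h2 : x ∈ G j <;> simp [h1, h2]
    have hint2 : ∀ i ∈ I, ∀ j ∈ I,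
        Integrable ((G i ∩ G j).indicator fun _ => (1 : ℝ)) (μ.restrict F) := fun i hi j hj =>
      hint _ (inter_subset_left.trans (hGF i hi)) ((hG i hi).inter (hG j hj))
    have hf2int : Integrable (fun x => f x ^ 2) (μ.restrict F) := by
      simp only [hf2]
      exact integrable_finsetSum _ fun i hi => integrable_finsetSum _ fun j hj => hint2 i hi j hj
    have h1 : ∫ x in F, f x ∂μ = S := by
      rw [hf, integral_finsetSum _ fun i hi => hint _ (hGF i hi) (hG i hi)]
      exact Finset.sum_congr rfl fun i hi => hval _ (hGF i hi) (hG i hi)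
    have h2 : ∫ x in F, f x ^ 2 ∂μ = ∑ i ∈ I, ∑ j ∈ I, μ.real (G i ∩ G j) := by
      simp only [hf2]
      rw [integral_finsetSum _ fun i hi => integrable_finsetSum _ fun j hj => hint2 i hi j hj]
      refine Finset.sum_congr rfl fun i hi => ?_
      rw [integral_finsetSum _ fun j hj => hint2 i hi j hj]
      exact Finset.sum_congr rfl fun j hj => hval _ (inter_subset_left.trans (hGF i hi))
        ((hG i hi).inter (hG j hj))
    have h3 : 0 ≤ ∫ x in F, (f x - S / m) ^ 2 ∂μ := integral_nonneg fun x => sq_nonneg _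
    have h4 : ∫ x in F, (f x - S / m) ^ 2 ∂μ =
        (∑ i ∈ I, ∑ j ∈ I, μ.real (G i ∩ G j)) - 2 * (S / m) * S + (S / m) ^ 2 * m := by
      have : ∀ x, (f x - S / m) ^ 2 = f x ^ 2 - 2 * (S / m) * f x + (S / m) ^ 2 := fun x => by ring
      have hconst : Integrable (fun _ : X => (S / m) ^ 2) (μ.restrict F) :=
        integrableOn_const hF.lt_top.ne
      simp only [this]
      have hadd := integral_add (hf2int.sub (hfint.const_mul (2 * (S / m)))) hconst
      simp only [Pi.sub_apply] at hadd
      rw [hadd, integral_sub hf2int (hfint.const_mul _), integral_const_mul, h1, h2, setIntegral_const,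
        smul_eq_mul]
      ring
    rw [h4] at h3
    have h5 : (S / m) ^ 2 * m = S ^ 2 / m := by field_simp
    have h6 : 2 * (S / m) * S = 2 * (S ^ 2 / m) := by ring
    rw [h5, h6] at h3
    have h7 : S ^ 2 / m ≤ ∑ i ∈ I, ∑ j ∈ I, μ.real (G i ∩ G j) := by linarith
    rwa [div_le_iff₀ hm, mul_comm] at h7
  have hrow : ∀ i ∈ I, ∑ j ∈ I, μ.real (G i ∩ G j) ≤
      N * μ.real (G i) + I.card * (c ^ 2 / 2 * m) := by
    intro i hi
    rw [← Finset.sum_filter_add_sum_filter_not I (fun j => c ^ 2 / 2 * m ≤ μ.real (G i ∩ G j))]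
    gcongr
    · calc _ ≤ ∑ j ∈ I with c ^ 2 / 2 * m ≤ μ.real (G i ∩ G j), μ.real (G i) :=
            Finset.sum_le_sum fun j _ => measureReal_mono inter_subset_left (hfin _ (hGF i hi))
        _ ≤ _ := by
            rw [Finset.sum_const, nsmul_eq_mul]
            gcongr
            exact hN i hi _ (Finset.filter_subset _ _) fun j hj => (Finset.mem_filter.1 hj).2
    · calc _ ≤ ∑ j ∈ I with ¬ c ^ 2 / 2 * m ≤ μ.real (G i ∩ G j), c ^ 2 / 2 * m :=
            Finset.sum_le_sum fun j hj => (not_le.1 (Finset.mem_filter.1 hj).2).le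
        _ ≤ _ := by
            rw [Finset.sum_const, nsmul_eq_mul]
            gcongr
            exact Finset.filter_subset _ _
  have htot : S ^ 2 ≤ m * (N * S) + (I.card * c * m) ^ 2 / 2 := by
    calc S ^ 2 ≤ m * ∑ i ∈ I, (N * μ.real (G i) + I.card * (c ^ 2 / 2 * m)) :=
          hCS.trans (by gcongr with i hi; exact hrow i hi)
      _ = _ := by
          rw [Finset.sum_add_distrib, ← Finset.mul_sum, Finset.sum_const, nsmul_eq_mul]
          ring
  have hlow : I.card * c * m ≤ S := by
    calc _ = ∑ i ∈ I, c * m := by rw [Finset.sum_const, nsmul_eq_mul, mul_assoc]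
      _ ≤ S := Finset.sum_le_sum hcG
  have hlow2 : (I.card * c * m) ^ 2 ≤ S ^ 2 := by gcongr
  rcases I.eq_empty_or_nonempty with rfl | ⟨i, hi⟩
  · simp only [hS, Finset.sum_empty]
    positivity
  · have hSpos : 0 < S := lt_of_lt_of_le (by
      have : 0 < I.card := Finset.card_pos.2 ⟨i, hi⟩
      positivity) hlow
    by_contra! hlt
    nlinarith

lemma setLIntegral_le_level_add {X : Type*} [MeasurableSpace X] {μ : Measure X} {φ : X → ℝ≥0∞}
    (hφ : Measurable φ) (F : Set X) (t : ℝ≥0∞) :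
    ∫⁻ x in F, φ x ∂μ ≤ ∫⁻ x in F ∩ {x | t ≤ φ x}, φ x ∂μ + t * μ F := by
  have hm : MeasurableSet {x | t ≤ φ x} := measurableSet_le measurable_const hφ
  rw [← lintegral_inter_add_sdiff φ F hm]
  gcongr
  calc ∫⁻ x in F \ {x | t ≤ φ x}, φ x ∂μ ≤ ∫⁻ _ in F \ {x | t ≤ φ x}, t ∂μ :=
        setLIntegral_mono measurable_const fun x hx => (not_le.1 hx.2).le
    _ ≤ t * μ F := by
        rw [setLIntegral_const]
        gcongr
        exact sdiff_subset

lemma rpow_eq_exp {x : ℝ} (hx : 0 < x) (p : ℝ) : x ^ p = Real.exp (Real.log x * p) :=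
  Real.rpow_def_of_pos hx p

lemma Hyp1.exists_log_bound {n : ℕ} {r s : ℝ}
    {S : Set (EuclideanSpace ℝ (Fin n)) → EuclideanSpace ℝ (Fin n) → ℝ≥0∞}
    (hr : 1 < r) (hrs : r < s) (h : Hyp1 n r s S) :
    ∃ γ C : ℝ, 0 < γ ∧ ∀ E₁ E₂ F : Set (EuclideanSpace ℝ (Fin n)),
      PosFinite volume E₁ → PosFinite volume E₂ → PosFinite volume F →
      ∀ a₁ a₂ b₁ b₂ : ℝ, a₁ ≤ a₂ → b₂ ≤ b₁ →
      (∀ x ∈ F, ENNReal.ofReal (Real.exp a₁) ≤ S E₁ x) →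
      (∀ x ∈ F, ENNReal.ofReal (Real.exp a₂) ≤ S E₂ x) →
      ENNReal.ofReal (Real.exp b₁ * volume.real E₁) ≤ calS n S E₁ F →
      ENNReal.ofReal (Real.exp b₂ * volume.real E₂) ≤ calS n S E₂ F →
      ∃ p q : ℝ, γ ≤ p / r - q * (1 - 1 / r) - 1 ∧
        a₁ * (r * (s - 1) / (s - r) - p) + a₂ * p + b₁ * (r / (s - r) - q) + b₂ * q ≤
          C + Real.log (volume.real E₂) := by
  obtain ⟨U, C₁, hC₁, hU, H⟩ := h
  have hγ : ∃ γ : ℝ, 0 < γ ∧ ∀ u ∈ U, γ ≤ u.2.1 / r - u.2.2.2 / (r / (r - 1)) - 1 := by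
    rcases U.eq_empty_or_nonempty with rfl | hne
    · exact ⟨1, one_pos, by simp⟩
    · obtain ⟨u, hu, hmin⟩ := Finset.exists_min_image U
        (fun u => u.2.1 / r - u.2.2.2 / (r / (r - 1)) - 1) hne
      exact ⟨_, (hU u hu).2.2, hmin⟩
  obtain ⟨γ, hγ0, hγ⟩ := hγ
  refine ⟨γ, Real.log C₁, hγ0, ?_⟩
  intro E₁ E₂ F hE₁ hE₂ hF a₁ a₂ b₁ b₂ ha hb hS₁ hS₂ hT₁ hT₂
  obtain ⟨u, hu, hle⟩ := H E₁ E₂ F hE₁.1 hE₂.1 hF.1 hE₁.2 hE₁.3 hE₂.2 hE₂.3 hF.2 hF.3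
    (Real.exp a₁) (Real.exp a₂) (Real.exp b₁) (Real.exp b₂) (Real.exp_pos _)
    (Real.exp_le_exp.2 ha) (Real.exp_pos _) (Real.exp_le_exp.2 hb) hS₁ hS₂
    (by rwa [← ofReal_measureReal hE₁.3.ne, ← ENNReal.ofReal_mul (Real.exp_pos _).le])
    (by rwa [← ofReal_measureReal hE₂.3.ne, ← ENNReal.ofReal_mul (Real.exp_pos _).le])
  obtain ⟨hu1, hu2, -⟩ := hU u hu
  have hr1 : r - 1 ≠ 0 := by linarith
  have hs1 : s - 1 ≠ 0 := by linarith
  have hsr : s - r ≠ 0 := by linarith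
  have hr0 : r ≠ 0 := by linarith
  refine ⟨u.2.1, u.2.2.2, ?_, ?_⟩
  · refine (hγ u hu).trans_eq ?_
    field_simp
  · have hA : (r / (r - 1)) / (r / (r - 1) - s / (s - 1)) = r * (s - 1) / (s - r) := by
      have : r / (r - 1) - s / (s - 1) = (s - r) / ((r - 1) * (s - 1)) := by
        field_simp
        ring
      rw [this]
      field_simp
    rw [hA] at hu1
    rw [← hu1, ← hu2, add_sub_cancel_right, add_sub_cancel_right]
    rw [← ofReal_measureReal hE₂.3.ne, ← ENNReal.ofReal_mul hC₁.le,
      ENNReal.ofReal_le_ofReal_iff (mul_pos hC₁ hE₂.real_pos).le,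
      ← Real.exp_mul, ← Real.exp_mul, ← Real.exp_mul, ← Real.exp_mul, ← Real.exp_add,
      ← Real.exp_add, ← Real.exp_add] at hle
    have := Real.log_le_log (Real.exp_pos _) hle
    rwa [Real.log_exp, Real.log_mul hC₁.ne' hE₂.real_pos.ne'] at this

/-- Restricted weak type `(r, s)` follows from `Hyp1` with both sets equal. -/
lemma Hyp1.exists_restricted_bound {n : ℕ} {r s : ℝ}
    {S : Set (EuclideanSpace ℝ (Fin n)) → EuclideanSpace ℝ (Fin n) → ℝ≥0∞}
    (hr : 1 < r) (hrs : r < s) (h : Hyp1 n r s S)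
    (hS : ∀ E : Set (EuclideanSpace ℝ (Fin n)), MeasurableSet E → Measurable (S E)) :
    ∃ C : ℝ, 0 < C ∧ ∀ E F : Set (EuclideanSpace ℝ (Fin n)),
      PosFinite volume E → PosFinite volume F →
      calS n S E F ≤
        ENNReal.ofReal (C * (volume.real E ^ (1 / r) * volume.real F ^ (1 - 1 / s))) := by
  obtain ⟨γ, C, -, H⟩ := h.exists_log_bound hr hrs
  have hr0 : 0 < r := by linarith
  have hs0 : 0 < s := by linarith
  have hsr : 0 < s - r := by linarith
  refine ⟨2 * Real.exp (C * (s - r) / (r * s)), by positivity, fun E F hE hF => ?_⟩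
  by_contra! hlt
  obtain ⟨t, ht0, hDt, htS⟩ := ENNReal.lt_iff_exists_real_btwn.1 hlt
  have hx := hE.real_pos
  have hy := hF.real_pos
  have htpos : 0 < t := ENNReal.ofReal_pos.1 (bot_le.trans_lt hDt)
  have hDt' := (ENNReal.ofReal_lt_ofReal_iff htpos).1 hDt
  set x := volume.real E
  set y := volume.real F
  set α := t / (2 * y) with hα
  have hα0 : 0 < α := by positivity
  set G := F ∩ {z | ENNReal.ofReal α ≤ S E z} with hG
  have hGm : MeasurableSet G := hF.1.inter (measurableSet_le measurable_const (hS E hE.1))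
  have hhalf : ENNReal.ofReal (t / 2) ≤ calS n S E G := by
    have h1 := setLIntegral_le_level_add (μ := volume) (hS E hE.1) F (ENNReal.ofReal α)
    have h2 : ENNReal.ofReal α * volume F = ENNReal.ofReal (t / 2) := by
      rw [← ofReal_measureReal hF.3.ne, ← ENNReal.ofReal_mul hα0.le]
      congr 1
      change t / (2 * y) * y = t / 2
      field_simp
    rw [h2] at h1
    have h3 := htS.le.trans h1
    nth_rewrite 1 [show t = t / 2 + t / 2 by ring] at h3
    rw [ENNReal.ofReal_add (by positivity) (by positivity)] at h3
    exact (ENNReal.add_le_add_iff_right ENNReal.ofReal_ne_top).1 h3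
  have hGpos : PosFinite volume G := by
    refine ⟨hGm, pos_iff_ne_zero.2 fun h0 => ?_, (measure_mono inter_subset_left).trans_lt hF.3⟩
    rw [calS, setLIntegral_measure_zero _ _ h0] at hhalf
    exact absurd hhalf (not_le.2 (ENNReal.ofReal_pos.2 (by positivity)))
  have hexpb : Real.exp (Real.log (t / 2 / x)) * x = t / 2 := by
    rw [Real.exp_log (by positivity)]
    field_simp
  obtain ⟨p, q, -, hpq⟩ := H E E G hE hE hGpos (Real.log α) (Real.log α) (Real.log (t / 2 / x))
    (Real.log (t / 2 / x)) le_rfl le_rfl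
    (fun z hz => by rw [Real.exp_log hα0]; exact hz.2)
    (fun z hz => by rw [Real.exp_log hα0]; exact hz.2)
    (by rwa [hexpb]) (by rwa [hexpb])
  have hlogα : Real.log α = Real.log (t / 2) - Real.log y := by
    rw [← Real.log_div (by positivity) hy.ne', hα, div_div]
  have hlogβ : Real.log (t / 2 / x) = Real.log (t / 2) - Real.log x :=
    Real.log_div (by positivity) hx.ne'
  have hfin : Real.log (t / 2) ≤
      C * (s - r) / (r * s) + (Real.log x * (1 / r) + Real.log y * (1 - 1 / s)) := by
    rw [hlogα, hlogβ] at hpq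
    have h1 : (Real.log (t / 2) - Real.log y) * (r * (s - 1) / (s - r)) +
        (Real.log (t / 2) - Real.log x) * (r / (s - r)) ≤ C + Real.log x := by
      linarith
    rw [← mul_div_assoc, ← mul_div_assoc, ← add_div, div_le_iff₀ hsr] at h1
    have h2 : C * (s - r) / (r * s) + (Real.log x * (1 / r) + Real.log y * (1 - 1 / s)) =
        (C * (s - r) + Real.log x * s + Real.log y * (r * (s - 1))) / (r * s) := by
      field_simp
      ring
    rw [h2, le_div_iff₀ (by positivity)]
    linarith
  have := Real.exp_le_exp.2 hfin
  rw [Real.exp_log (by positivity), Real.exp_add, Real.exp_add, ← rpow_eq_exp hx,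
    ← rpow_eq_exp hy] at this
  linarith

lemma Hyp1.exists_log_volume_sub_le {n : ℕ} {r s : ℝ}
    {S : Set (EuclideanSpace ℝ (Fin n)) → EuclideanSpace ℝ (Fin n) → ℝ≥0∞}
    (hr : 1 < r) (hrs : r < s) (h : Hyp1 n r s S) :
    ∃ D : ℝ, 0 < D ∧ ∀ ε c : ℝ, 0 < ε → ε ≤ 1 → 0 < c → c ≤ 1 →
      ∀ E₁ E₂ F G : Set (EuclideanSpace ℝ (Fin n)),
      PosFinite volume E₁ → PosFinite volume E₂ → PosFinite volume F → MeasurableSet G →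
      G ⊆ F → c * volume.real F ≤ volume.real G →
      (∀ x ∈ G, ENNReal.ofReal (ε * (volume.real E₁ ^ (1 / r) * volume.real F ^ (-(1 / s)))) ≤
        S E₁ x) →
      (∀ x ∈ G, ENNReal.ofReal (ε * (volume.real E₂ ^ (1 / r) * volume.real F ^ (-(1 / s)))) ≤
        S E₂ x) →
      Real.log (volume.real E₁) ≤ Real.log (volume.real E₂) →
      Real.log (volume.real E₂) - Real.log (volume.real E₁) ≤
        D * (1 - Real.log ε - Real.log c) := by
  obtain ⟨γ, C, hγ, H⟩ := h.exists_log_bound hr hrs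
  have hr0 : 0 < r := by linarith
  have hs0 : 0 < s := by linarith
  have hs1 : 0 < s - 1 := by linarith
  have hsr : 0 < s - r := by linarith
  set A := r * (s - 1) / (s - r) with hA
  set B := r / (s - r) with hB
  have hA0 : 0 < A := by positivity
  have hB0 : 0 < B := by positivity
  have h1r : 0 < 1 - 1 / r := by
    rw [sub_pos, div_lt_one hr0]; exact hr
  refine ⟨(|C| + A + B) / γ, by positivity, ?_⟩
  intro ε c hε hε1 hc hc1 E₁ E₂ F G hE₁ hE₂ hF hGm hGF hcG hS₁ hS₂ hle
  have hy := hF.real_pos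
  have hG : PosFinite volume G := hF.of_subset_of_le hGm hGF (by positivity) hcG
  have hexp : ∀ E : Set (EuclideanSpace ℝ (Fin n)), PosFinite volume E →
      ε * (volume.real E ^ (1 / r) * volume.real F ^ (-(1 / s))) =
      Real.exp (Real.log ε + (Real.log (volume.real E) * (1 / r) +
        Real.log (volume.real F) * (-(1 / s)))) := by
    intro E hE
    rw [rpow_eq_exp hE.real_pos, rpow_eq_exp hy, Real.exp_add, Real.exp_add, Real.exp_log hε]
  have hβ : ∀ E : Set (EuclideanSpace ℝ (Fin n)), PosFinite volume E →
      (∀ x ∈ G, ENNReal.ofReal (ε * (volume.real E ^ (1 / r) * volume.real F ^ (-(1 / s)))) ≤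
        S E x) →
      ENNReal.ofReal (Real.exp (Real.log ε + Real.log c - Real.log (volume.real E) * (1 - 1 / r) +
        Real.log (volume.real F) * (1 - 1 / s)) * volume.real E) ≤ calS n S E G := by
    intro E hE hS
    calc _ = ENNReal.ofReal (ε * (volume.real E ^ (1 / r) * volume.real F ^ (-(1 / s))) *
          (c * volume.real F)) := by
          rw [hexp E hE]
          congr 1
          nth_rewrite 2 [← Real.exp_log hE.real_pos]
          have hcy : c * volume.real F = Real.exp (Real.log c + Real.log (volume.real F)) := by
            rw [Real.exp_add, Real.exp_log hc, Real.exp_log hy]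
          rw [hcy, ← Real.exp_add, ← Real.exp_add]
          congr 1
          ring
      _ ≤ ENNReal.ofReal (ε * (volume.real E ^ (1 / r) * volume.real F ^ (-(1 / s)))) *
          volume G := by
          have hE' := hE.real_pos
          rw [ENNReal.ofReal_mul (by positivity), ← ofReal_measureReal hG.3.ne]
          gcongr
      _ ≤ calS n S E G := by
          rw [← setLIntegral_const]
          exact setLIntegral_mono' hGm hS
  have h1 := hβ E₁ hE₁ hS₁
  have h2 := hβ E₂ hE₂ hS₂
  simp only [hexp E₁ hE₁] at hS₁
  simp only [hexp E₂ hE₂] at hS₂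
  set x₁ := Real.log (volume.real E₁)
  set x₂ := Real.log (volume.real E₂)
  set z := Real.log (volume.real F)
  have hr1 : 0 < 1 / r := by positivity
  obtain ⟨p, q, hγpq, hpq⟩ := H E₁ E₂ G hE₁ hE₂ hG _ _ _ _
    (by gcongr) (by gcongr) hS₁ hS₂ h1 h2
  have hAB1 : A * (1 / r) - B * (1 - 1 / r) = 1 := by
    rw [hA, hB]; field_simp; ring
  have hAB2 : A * (1 / s) = B * (1 - 1 / s) := by
    rw [hA, hB]; field_simp
  have hlε : Real.log ε ≤ 0 := Real.log_nonpos hε.le hε1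
  have hlc : Real.log c ≤ 0 := Real.log_nonpos hc.le hc1
  have hkey : (p / r - q * (1 - 1 / r) - 1) * (x₂ - x₁) ≤
      C - (A + B) * Real.log ε - B * Real.log c := by
    have hexpand : (Real.log ε + (x₁ * (1 / r) + z * -(1 / s))) * (A - p) +
        (Real.log ε + (x₂ * (1 / r) + z * -(1 / s))) * p +
        (Real.log ε + Real.log c - x₁ * (1 - 1 / r) + z * (1 - 1 / s)) * (B - q) +
        (Real.log ε + Real.log c - x₂ * (1 - 1 / r) + z * (1 - 1 / s)) * q =
        (A + B) * Real.log ε + B * Real.log c + x₁ +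
        (p / r - q * (1 - 1 / r)) * (x₂ - x₁) := by
      linear_combination x₁ * hAB1 - z * hAB2
    rw [hexpand] at hpq
    linarith
  have hγle : γ * (x₂ - x₁) ≤ (p / r - q * (1 - 1 / r) - 1) * (x₂ - x₁) :=
    mul_le_mul_of_nonneg_right hγpq (by linarith)
  rw [div_mul_eq_mul_div, le_div_iff₀ hγ]
  have hC := le_abs_self C
  have hC0 := abs_nonneg C
  nlinarith [mul_nonneg hC0 (neg_nonneg.2 hlε), mul_nonneg hC0 (neg_nonneg.2 hlc),
    mul_nonneg hA0.le (neg_nonneg.2 hlc)]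

lemma card_le_of_abs_sub_le {I : Finset ℤ} {i : ℤ} {L : ℝ} (hL : 0 ≤ L)
    (h : ∀ j ∈ I, |(i : ℝ) - j| ≤ L) : (I.card : ℝ) ≤ 2 * L + 1 := by
  have hfl : 0 ≤ ⌊L⌋ := Int.floor_nonneg.2 hL
  have hsub : I ⊆ Finset.Icc (i - ⌊L⌋) (i + ⌊L⌋) := by
    intro j hj
    have h1 : |i - j| ≤ ⌊L⌋ := Int.le_floor.2 (by push_cast; exact h j hj)
    rw [abs_le] at h1
    exact Finset.mem_Icc.2 ⟨by linarith, by linarith⟩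
  have h2 := Finset.card_le_card hsub
  rw [Int.card_Icc] at h2
  have h3 : (I.card : ℤ) ≤ 2 * ⌊L⌋ + 1 := by omega
  calc (I.card : ℝ) ≤ 2 * (⌊L⌋ : ℝ) + 1 := by exact_mod_cast h3
    _ ≤ 2 * L + 1 := by gcongr; exact Int.floor_le L

/-- Logarithmic bound for the total size of the level sets of `S (E i)` in a fixed set `F`. -/
lemma Hyp1.exists_sum_level_sets_bound {n : ℕ} {r s : ℝ}
    {S : Set (EuclideanSpace ℝ (Fin n)) → EuclideanSpace ℝ (Fin n) → ℝ≥0∞}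
    (hr : 1 < r) (hrs : r < s) (h : Hyp1 n r s S) {q τ : ℝ} (hq : 0 < q) (hτ : 0 < τ) :
    ∃ C : ℝ, 0 < C ∧ ∀ ε η : ℝ, 0 < ε → ε ≤ 1 → 0 < η →
      ∀ F : Set (EuclideanSpace ℝ (Fin n)), PosFinite volume F →
      ∀ (I : Finset ℤ) (E G : ℤ → Set (EuclideanSpace ℝ (Fin n))),
      (∀ i ∈ I, PosFinite volume (E i)) → (∀ i ∈ I, MeasurableSet (G i)) → (∀ i ∈ I, G i ⊆ F) →
      (∀ i ∈ I, ∀ x ∈ G i, ENNReal.ofReal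
        (ε * (volume.real (E i) ^ (1 / r) * volume.real F ^ (-(1 / s)))) ≤ S (E i) x) →
      (∀ i ∈ I, ε ^ q * volume.real F ≤ volume.real (G i)) →
      (∀ i ∈ I, η < (2 : ℝ) ^ i * volume.real (E i) ^ (1 / r) ∧
        (2 : ℝ) ^ i * volume.real (E i) ^ (1 / r) ≤ 2 * η) →
      ∑ i ∈ I, volume.real (G i) ≤ C * ε ^ (-τ) * volume.real F := by
  obtain ⟨D, hD, H⟩ := h.exists_log_volume_sub_le hr hrs
  have hr0 : 0 < r := by linarith
  have hl2 : 0 < Real.log 2 := Real.log_pos one_lt_two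
  refine ⟨2 * (3 + 2 * D / Real.log 2 * (1 + Real.log 2 + (1 + 2 * q) / τ)), by positivity, ?_⟩
  intro ε η hε hε1 hη F hF I E G hE hGm hGF hS hG hEη
  have hlε : Real.log ε ≤ 0 := Real.log_nonpos hε.le hε1
  set L : ℝ := 1 + D / Real.log 2 * (1 + Real.log 2 + (1 + 2 * q) * (-Real.log ε)) with hL
  have hL0 : 0 ≤ L := by
    have : 0 ≤ -Real.log ε := by linarith
    positivity
  have hεq : ε ^ q ≤ 1 := Real.rpow_le_one hε.le hε1 hq.le
  have hεq0 : 0 < ε ^ q := by positivity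
  have hc : 0 < (ε ^ q) ^ 2 / 2 := by positivity
  have hlogc : Real.log ((ε ^ q) ^ 2 / 2) = 2 * q * Real.log ε - Real.log 2 := by
    rw [Real.log_div (by positivity) two_ne_zero, Real.log_pow, Real.log_rpow hε]
    push_cast
    ring
  have hbd := sum_measureReal_le_of_overlap (N := 2 * L + 1) hF hGm hGF (c := ε ^ q)
    (by positivity) (by positivity) hG (by
      intro i hi I' hI' hov
      refine card_le_of_abs_sub_le (i := i) hL0 fun j hj' => ?_
      have hj := hI' hj'
      have hlog : ∀ i ∈ I, Real.log η < i * Real.log 2 + 1 / r * Real.log (volume.real (E i)) ∧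
          i * Real.log 2 + 1 / r * Real.log (volume.real (E i)) ≤ Real.log 2 + Real.log η := by
        intro i hi
        have hx := (hE i hi).real_pos
        have : Real.log ((2 : ℝ) ^ i * volume.real (E i) ^ (1 / r)) =
            i * Real.log 2 + 1 / r * Real.log (volume.real (E i)) := by
          rw [Real.log_mul (by positivity) (by positivity), Real.log_zpow, Real.log_rpow hx]
        rw [← this, ← Real.log_mul two_ne_zero hη.ne']
        exact ⟨Real.log_lt_log hη (hEη i hi).1, Real.log_le_log (by positivity) (hEη i hi).2⟩
      obtain ⟨hi1, hi2⟩ := hlog i hi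
      obtain ⟨hj1, hj2⟩ := hlog j hj
      have hdiff : |Real.log (volume.real (E i)) - Real.log (volume.real (E j))| ≤
          D * (1 + Real.log 2 + (1 + 2 * q) * (-Real.log ε)) := by
        have heq : D * (1 + Real.log 2 + (1 + 2 * q) * (-Real.log ε)) =
            D * (1 - Real.log ε - Real.log ((ε ^ q) ^ 2 / 2)) := by rw [hlogc]; ring
        have hc1 : (ε ^ q) ^ 2 / 2 ≤ 1 := by nlinarith
        rw [heq]
        rcases le_total (Real.log (volume.real (E i))) (Real.log (volume.real (E j))) with hle | hle
        · rw [abs_sub_comm, abs_of_nonneg (by linarith)]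
          exact H ε _ hε hε1 hc hc1 (E i) (E j) F (G i ∩ G j) (hE i hi) (hE j hj) hF
            ((hGm i hi).inter (hGm j hj)) (inter_subset_left.trans (hGF i hi)) (hov j hj')
            (fun x hx => hS i hi x hx.1) (fun x hx => hS j hj x hx.2) hle
        · rw [abs_of_nonneg (by linarith)]
          exact H ε _ hε hε1 hc hc1 (E j) (E i) F (G i ∩ G j) (hE j hj) (hE i hi) hF
            ((hGm i hi).inter (hGm j hj)) (inter_subset_left.trans (hGF i hi)) (hov j hj')
            (fun x hx => hS j hj x hx.2) (fun x hx => hS i hi x hx.1) hle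
      have hdiff' : |1 / r * Real.log (volume.real (E i)) -
          1 / r * Real.log (volume.real (E j))| ≤
          D * (1 + Real.log 2 + (1 + 2 * q) * (-Real.log ε)) := by
        rw [← mul_sub, abs_mul, abs_of_pos (by positivity)]
        refine le_trans ?_ hdiff
        exact mul_le_of_le_one_left (abs_nonneg _) ((div_le_one hr0).2 hr.le)
      rw [abs_le] at hdiff'
      have hmul : |((i : ℝ) - j) * Real.log 2| ≤
          Real.log 2 + D * (1 + Real.log 2 + (1 + 2 * q) * (-Real.log ε)) := by
        rw [abs_le]
        constructor <;> linarith [hdiff'.1, hdiff'.2]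
      rw [abs_mul, abs_of_pos hl2, ← le_div_iff₀ hl2] at hmul
      refine hmul.trans_eq ?_
      rw [hL]
      field_simp)
  refine hbd.trans ?_
  have hτ1 : 1 ≤ ε ^ (-τ) := Real.one_le_rpow_of_pos_of_le_one_of_nonpos hε hε1 (by linarith)
  have hlogle : -Real.log ε ≤ ε ^ (-τ) / τ := by
    have := Real.log_le_rpow_div (inv_nonneg.2 hε.le) hτ
    rwa [Real.log_inv, Real.inv_rpow hε.le, ← Real.rpow_neg hε.le] at this
  refine mul_le_mul_of_nonneg_right ?_ hF.real_pos.le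
  rw [mul_assoc]
  refine mul_le_mul_of_nonneg_left ?_ zero_le_two
  calc 2 * L + 1 = 3 + 2 * D / Real.log 2 * (1 + Real.log 2 + (1 + 2 * q) * (-Real.log ε)) := by
        rw [hL]; ring
    _ ≤ 3 * ε ^ (-τ) + 2 * D / Real.log 2 * ((1 + Real.log 2) * ε ^ (-τ) +
          (1 + 2 * q) * (ε ^ (-τ) / τ)) := by
        gcongr
        · linarith
        · exact le_mul_of_one_le_right (by positivity) hτ1
    _ = _ := by ring

/-- The part of a bilinear sum on which `T ≈ ε`, `e ≈ η`, `f ≈ δ`. -/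
lemma sum_dyadic_block_le {p q u w a b θ C ε η δ : ℝ} (hu : 0 < u) (hw : 0 < w)
    (ha : 0 ≤ a) (hb : 0 ≤ b) (hab : a + b = 1) (hap : a ≤ p) (hbq : b ≤ q)
    (hθ : 0 < θ) (hθ1 : θ < 1) (hC : 1 ≤ C) (hε : 0 < ε) (hε1 : ε ≤ 1) (hη : 0 < η) (hδ : 0 < δ)
    (J K : Finset ℤ) (e f : ℤ → ℝ) (T g h : ℤ → ℤ → ℝ) (P : Finset (ℤ × ℤ)) (hP : P ⊆ J ×ˢ K)
    (hPT : ∀ x ∈ P, ε < T x.1 x.2 ∧ T x.1 x.2 ≤ 2 * ε)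
    (hPe : ∀ x ∈ P, η < e x.1 ∧ e x.1 ≤ 2 * η)
    (hPf : ∀ x ∈ P, δ < f x.2 ∧ f x.2 ≤ 2 * δ)
    (he0 : ∀ j ∈ J, 0 ≤ e j) (hf0 : ∀ k ∈ K, 0 ≤ f k)
    (he : ∑ j ∈ J, e j ^ u ≤ 1) (hf : ∑ k ∈ K, f k ^ w ≤ 1)
    (hg : ∀ j ∈ J, ∀ k ∈ K, 0 ≤ g j k ∧ g j k ≤ 1)
    (hh : ∀ j ∈ J, ∀ k ∈ K, 0 ≤ h j k ∧ h j k ≤ 1)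
    (hT : ∀ j ∈ J, ∀ k ∈ K, T j k ≤ h j k ^ p * g j k ^ q)
    (hcol : ∀ k ∈ K, ∀ J' ⊆ J, (∀ j ∈ J', ε < T j k ∧ T j k ≤ 2 * ε ∧ η < e j ∧ e j ≤ 2 * η) →
      ∑ j ∈ J', g j k ≤ C * ε ^ (-(θ / 2)))
    (hrow : ∀ j ∈ J, ∀ K' ⊆ K, (∀ k ∈ K', ε < T j k ∧ T j k ≤ 2 * ε ∧ δ < f k ∧ f k ≤ 2 * δ) →
      ∑ k ∈ K', h j k ≤ C * ε ^ (-(θ / 2))) :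
    ∑ x ∈ P, e x.1 * f x.2 * T x.1 x.2 ≤
      8 * C * (ε ^ (θ / 2) * η ^ (1 - u * ((1 - θ) * a + θ)) * δ ^ (1 - w * ((1 - θ) * b + θ))) := by
  have hcard : ∀ (L : Finset ℤ) (e : ℤ → ℝ) (η u : ℝ), 0 < η → 0 < u → (∀ j ∈ L, 0 ≤ e j) →
      ∑ j ∈ L, e j ^ u ≤ 1 → ∀ L' ⊆ L, (∀ j ∈ L', η < e j) → (L'.card : ℝ) ≤ η ^ (-u) := by
    intro L e η u hη hu h0 hs L' hL' hL
    rw [Real.rpow_neg hη.le, ← one_div, le_div_iff₀ (by positivity), ← nsmul_eq_mul]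
    calc L'.card • η ^ u ≤ ∑ j ∈ L', e j ^ u :=
          Finset.card_nsmul_le_sum _ _ _ fun j hj => Real.rpow_le_rpow hη.le (hL j hj).le hu.le
      _ ≤ ∑ j ∈ L, e j ^ u :=
          Finset.sum_le_sum_of_subset_of_nonneg hL' fun j hj _ => Real.rpow_nonneg (h0 j hj) _
      _ ≤ 1 := hs
  have hmem : ∀ x ∈ P, x.1 ∈ J ∧ x.2 ∈ K := fun x hx => Finset.mem_product.1 (hP hx)
  have h1subs : P.image Prod.fst ⊆ J := by
    intro j hj
    obtain ⟨x, hx, rfl⟩ := Finset.mem_image.1 hj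
    exact (hmem x hx).1
  have h2subs : P.image Prod.snd ⊆ K := by
    intro j hj
    obtain ⟨x, hx, rfl⟩ := Finset.mem_image.1 hj
    exact (hmem x hx).2
  have hJc : ((P.image Prod.fst).card : ℝ) ≤ η ^ (-u) := by
    refine hcard J e η u hη hu he0 he _ h1subs fun j hj => ?_
    obtain ⟨x, hx, rfl⟩ := Finset.mem_image.1 hj
    exact (hPe x hx).1
  have hKc : ((P.image Prod.snd).card : ℝ) ≤ δ ^ (-w) := by
    refine hcard K f δ w hδ hw hf0 hf _ h2subs fun j hj => ?_
    obtain ⟨x, hx, rfl⟩ := Finset.mem_image.1 hj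
    exact (hPf x hx).1
  set M := C * ε ^ (-(θ / 2)) with hM
  have hM0 : 0 < M := by positivity
  set A := η ^ (-u) with hA
  set B := δ ^ (-w) with hB
  have hA0 : 0 < A := by positivity
  have hB0 : 0 < B := by positivity
  have hN : ∑ x ∈ P, (1 : ℝ) ≤ A * B := by
    have : P.card ≤ (P.image Prod.fst).card * (P.image Prod.snd).card := by
      rw [← Finset.card_product]
      exact Finset.card_le_card Finset.subset_product
    simp only [Finset.sum_const, nsmul_eq_mul, mul_one]
    calc (P.card : ℝ) ≤ (P.image Prod.fst).card * (P.image Prod.snd).card := by exact_mod_cast this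
      _ ≤ A * B := by gcongr
  have hX : ∑ x ∈ P, h x.1 x.2 ≤ M * A := by
    rw [← Finset.sum_fiberwise_of_maps_to (t := P.image Prod.fst) (g := Prod.fst)
      fun x hx => Finset.mem_image_of_mem _ hx]
    calc _ ≤ ∑ _j ∈ P.image Prod.fst, M := by
          refine Finset.sum_le_sum fun j hj => ?_
          have : ∑ x ∈ P with x.1 = j, h x.1 x.2 =
              ∑ k ∈ ({x ∈ P | x.1 = j}).image Prod.snd, h j k := by
            rw [Finset.sum_image]
            · exact Finset.sum_congr rfl fun x hx => by rw [(Finset.mem_filter.1 hx).2]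
            · intro x hx y hy hxy
              exact Prod.ext (((Finset.mem_filter.1 hx).2).trans
                ((Finset.mem_filter.1 hy).2).symm) hxy
          rw [this]
          refine hrow j (h1subs hj) _ ?_ ?_
          · exact (Finset.image_subset_image (Finset.filter_subset _ _)).trans h2subs
          · intro k hk
            obtain ⟨x, hx, rfl⟩ := Finset.mem_image.1 hk
            obtain ⟨hxP, rfl⟩ := Finset.mem_filter.1 hx
            exact ⟨(hPT x hxP).1, (hPT x hxP).2, hPf x hxP⟩
      _ ≤ M * A := by
          rw [Finset.sum_const, nsmul_eq_mul, mul_comm]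
          gcongr
  have hY : ∑ x ∈ P, g x.1 x.2 ≤ M * B := by
    rw [← Finset.sum_fiberwise_of_maps_to (t := P.image Prod.snd) (g := Prod.snd)
      fun x hx => Finset.mem_image_of_mem _ hx]
    calc _ ≤ ∑ _j ∈ P.image Prod.snd, M := by
          refine Finset.sum_le_sum fun j hj => ?_
          have : ∑ x ∈ P with x.2 = j, g x.1 x.2 =
              ∑ k ∈ ({x ∈ P | x.2 = j}).image Prod.fst, g k j := by
            rw [Finset.sum_image]
            · exact Finset.sum_congr rfl fun x hx => by rw [(Finset.mem_filter.1 hx).2]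
            · intro x hx y hy hxy
              exact Prod.ext hxy (((Finset.mem_filter.1 hx).2).trans
                ((Finset.mem_filter.1 hy).2).symm)
          rw [this]
          refine hcol j (h2subs hj) _ ?_ ?_
          · exact (Finset.image_subset_image (Finset.filter_subset _ _)).trans h1subs
          · intro k hk
            obtain ⟨x, hx, rfl⟩ := Finset.mem_image.1 hk
            obtain ⟨hxP, rfl⟩ := Finset.mem_filter.1 hx
            exact ⟨(hPT x hxP).1, (hPT x hxP).2, hPe x hxP⟩
      _ ≤ M * B := by
          rw [Finset.sum_const, nsmul_eq_mul, mul_comm]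
          gcongr
  have h1θ : 0 < 1 - θ := by linarith
  set a' := (1 - θ) * a with ha'
  set b' := (1 - θ) * b with hb'
  have ha0 : 0 ≤ a' := by positivity
  have hb0 : 0 ≤ b' := by positivity
  have hsum1 : a' + b' + θ = 1 := by rw [ha', hb']; linear_combination (1 - θ) * hab
  set Z := (M * A) ^ a' * (M * B) ^ b' * (A * B) ^ θ with hZ
  have hZ0 : 0 < Z := by positivity
  have hterm : ∀ x ∈ P, T x.1 x.2 ≤ (2 * ε) ^ θ * (Z *
      (a' * (h x.1 x.2 / (M * A)) + b' * (g x.1 x.2 / (M * B)) + θ * (1 / (A * B)))) := by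
    intro x hx
    obtain ⟨hj, hk⟩ := hmem x hx
    obtain ⟨hg0, hg1⟩ := hg _ hj _ hk
    obtain ⟨hh0, hh1⟩ := hh _ hj _ hk
    have hTpos : 0 < T x.1 x.2 := hε.trans (hPT x hx).1
    set t := T x.1 x.2 with ht
    calc t = t ^ θ * t ^ (1 - θ) := by
          rw [← Real.rpow_add hTpos, add_sub_cancel, Real.rpow_one]
      _ ≤ (2 * ε) ^ θ * (h x.1 x.2 ^ a * g x.1 x.2 ^ b) ^ (1 - θ) := by
          gcongr
          · exact (hPT x hx).2
          · exact (hT _ hj _ hk).trans (mul_le_mul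
              (Real.rpow_le_rpow_of_exponent_ge' hh0 hh1 ha hap)
              (Real.rpow_le_rpow_of_exponent_ge' hg0 hg1 hb hbq)
              (Real.rpow_nonneg hg0 _) (Real.rpow_nonneg hh0 _))
      _ = (2 * ε) ^ θ * (Z * ((h x.1 x.2 / (M * A)) ^ a' * (g x.1 x.2 / (M * B)) ^ b' *
            (1 / (A * B)) ^ θ)) := by
          rw [Real.mul_rpow (Real.rpow_nonneg hh0 _) (Real.rpow_nonneg hg0 _),
            ← Real.rpow_mul hh0, ← Real.rpow_mul hg0, mul_comm a, mul_comm b, ← ha', ← hb',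
            Real.div_rpow hh0 (by positivity), Real.div_rpow hg0 (by positivity),
            Real.div_rpow zero_le_one (by positivity), Real.one_rpow, hZ]
          field_simp
      _ ≤ _ := by
          gcongr
          exact Real.geom_mean_le_arith_mean3_weighted ha0 hb0 hθ.le (by positivity)
            (by positivity) (by positivity) hsum1
  have hsumT : ∑ x ∈ P, T x.1 x.2 ≤ (2 * ε) ^ θ * Z := by
    refine (Finset.sum_le_sum hterm).trans ?_
    rw [← Finset.mul_sum, ← Finset.mul_sum]
    have : ∑ x ∈ P, (a' * (h x.1 x.2 / (M * A)) + b' * (g x.1 x.2 / (M * B)) +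
        θ * (1 / (A * B))) = a' * ((∑ x ∈ P, h x.1 x.2) / (M * A)) +
        b' * ((∑ x ∈ P, g x.1 x.2) / (M * B)) + θ * ((∑ x ∈ P, (1 : ℝ)) / (A * B)) := by
      simp only [Finset.sum_add_distrib, Finset.mul_sum, Finset.sum_div]
    rw [this]
    have h1 := (div_le_one (by positivity)).2 hX
    have h2 := (div_le_one (by positivity)).2 hY
    have h3 := (div_le_one (by positivity)).2 hN
    have : a' * ((∑ x ∈ P, h x.1 x.2) / (M * A)) + b' * ((∑ x ∈ P, g x.1 x.2) / (M * B)) +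
        θ * ((∑ x ∈ P, (1 : ℝ)) / (A * B)) ≤ 1 := by
      calc _ ≤ a' * 1 + b' * 1 + θ * 1 := by gcongr
        _ = 1 := by linarith
    calc _ ≤ (2 * ε) ^ θ * (Z * 1) := by gcongr
      _ = _ := by rw [mul_one]
  have hM1 : 1 ≤ M := one_le_mul_of_one_le_of_one_le hC
    (Real.one_le_rpow_of_pos_of_le_one_of_nonpos hε hε1 (by linarith))
  have hZle : Z ≤ M * (η ^ (-(u * (a' + θ))) * δ ^ (-(w * (b' + θ)))) := by
    have : Z = M ^ (1 - θ) * (η ^ (-(u * (a' + θ))) * δ ^ (-(w * (b' + θ)))) := by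
      rw [show 1 - θ = a' + b' by linarith, Real.rpow_add hM0, hZ,
        Real.mul_rpow hM0.le hA0.le, Real.mul_rpow hM0.le hB0.le, Real.mul_rpow hA0.le hB0.le,
        ← neg_mul, ← neg_mul, Real.rpow_mul hη.le, Real.rpow_mul hδ.le, ← hA, ← hB,
        Real.rpow_add hA0, Real.rpow_add hB0]
      ring
    rw [this]
    gcongr
    exact (Real.rpow_le_rpow_of_exponent_le hM1 (by linarith)).trans_eq (Real.rpow_one M)
  have h2θ : (2 : ℝ) ^ θ ≤ 2 :=
    (Real.rpow_le_rpow_of_exponent_le one_le_two hθ1.le).trans_eq (Real.rpow_one 2)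
  calc ∑ x ∈ P, e x.1 * f x.2 * T x.1 x.2
      ≤ ∑ x ∈ P, 2 * η * (2 * δ) * T x.1 x.2 := by
        refine Finset.sum_le_sum fun x hx => ?_
        have := hf0 _ (hmem x hx).2
        have := (hε.trans (hPT x hx).1).le
        gcongr
        · exact (hPe x hx).2
        · exact (hPf x hx).2
    _ = 2 * η * (2 * δ) * ∑ x ∈ P, T x.1 x.2 := by rw [Finset.mul_sum]
    _ ≤ 2 * η * (2 * δ) * ((2 * ε ^ θ) *
          (M * (η ^ (-(u * (a' + θ))) * δ ^ (-(w * (b' + θ)))))) := by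
        gcongr
        refine hsumT.trans ?_
        rw [Real.mul_rpow zero_le_two hε.le]
        gcongr
    _ = _ := by
        rw [hM, sub_eq_add_neg, sub_eq_add_neg 1, Real.rpow_add hη, Real.rpow_add hδ,
          Real.rpow_one, Real.rpow_one, show θ / 2 = θ + -(θ / 2) by ring, Real.rpow_add hε]
        ring_nf

lemma exists_bilinear_sum_bound {p q u w : ℝ} (hu : 1 ≤ u) (hw : 1 ≤ w) (hup : 1 / u ≤ p)
    (hwq : 1 / w ≤ q) (huw : 1 < 1 / u + 1 / w) :
    ∃ τ : ℝ, 0 < τ ∧ ∀ C : ℝ, 1 ≤ C → ∃ B : ℝ, 0 < B ∧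
    ∀ (J K : Finset ℤ) (e f : ℤ → ℝ) (T g h : ℤ → ℤ → ℝ),
    (∀ j ∈ J, 0 < e j) → (∀ k ∈ K, 0 < f k) →
    ∑ j ∈ J, e j ^ u ≤ 1 → ∑ k ∈ K, f k ^ w ≤ 1 →
    (∀ j ∈ J, ∀ k ∈ K, 0 ≤ g j k ∧ g j k ≤ 1) →
    (∀ j ∈ J, ∀ k ∈ K, 0 ≤ h j k ∧ h j k ≤ 1) →
    (∀ j ∈ J, ∀ k ∈ K, T j k ≤ h j k ^ p * g j k ^ q) →
    (∀ ε η : ℝ, 0 < ε → ε ≤ 1 → 0 < η → ∀ k ∈ K, ∀ J' ⊆ J,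
      (∀ j ∈ J', ε < T j k ∧ T j k ≤ 2 * ε ∧ η < e j ∧ e j ≤ 2 * η) →
      ∑ j ∈ J', g j k ≤ C * ε ^ (-τ)) →
    (∀ ε η : ℝ, 0 < ε → ε ≤ 1 → 0 < η → ∀ j ∈ J, ∀ K' ⊆ K,
      (∀ k ∈ K', ε < T j k ∧ T j k ≤ 2 * ε ∧ η < f k ∧ f k ≤ 2 * η) →
      ∑ k ∈ K', h j k ≤ C * ε ^ (-τ)) →
    ∑ j ∈ J, ∑ k ∈ K, e j * f k * T j k ≤ B := by
  have hu0 : 0 < u := by linarith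
  have hw0 : 0 < w := by linarith
  have hu1 : 1 / u ≤ 1 := (div_le_one hu0).2 hu
  have hw1 : 1 / w ≤ 1 := (div_le_one hw0).2 hw
  set a := (1 / u + (1 - 1 / w)) / 2 with ha
  set b := (1 / w + (1 - 1 / u)) / 2 with hb
  set θ := (1 / u + 1 / w - 1) / 4 with hθ
  have hθ0 : 0 < θ := by linarith
  have hθ1 : θ < 1 := by linarith
  have hau : u * ((1 - θ) * a + θ) < 1 := by
    have : (1 - θ) * a + θ < 1 / u := by nlinarith
    calc _ < u * (1 / u) := by gcongr
      _ = 1 := by field_simp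
  have hbw : w * ((1 - θ) * b + θ) < 1 := by
    have : (1 - θ) * b + θ < 1 / w := by nlinarith
    calc _ < w * (1 / w) := by gcongr
      _ = 1 := by field_simp
  refine ⟨θ / 2, by linarith, fun C hC => ?_⟩
  set W : ℕ × ℕ × ℕ → ℝ := fun c =>
    (((1 / 2 : ℝ) ^ (c.1 + 1)) ^ (θ / 2) *
      (((1 / 2 : ℝ) ^ (c.2.1 + 1)) ^ (1 - u * ((1 - θ) * a + θ)) *
      ((1 / 2 : ℝ) ^ (c.2.2 + 1)) ^ (1 - w * ((1 - θ) * b + θ)))) with hW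
  have hgeom : ∀ t : ℝ, 0 < t → Summable fun m : ℕ => ((1 / 2 : ℝ) ^ (m + 1)) ^ t := by
    intro t ht
    have : ∀ m : ℕ, ((1 / 2 : ℝ) ^ (m + 1)) ^ t = ((1 / 2 : ℝ) ^ t) ^ (m + 1) := fun m => by
      rw [← Real.rpow_natCast, ← Real.rpow_natCast, ← Real.rpow_mul (by norm_num),
        ← Real.rpow_mul (by norm_num), mul_comm]
    simp only [this]
    exact (summable_nat_add_iff 1).2 (summable_geometric_of_lt_one (by positivity)
      (Real.rpow_lt_one (by norm_num) (by norm_num) ht))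
  have hWsum : Summable W := by
    have h1 := hgeom (θ / 2) (by linarith)
    have h2 := hgeom (1 - u * ((1 - θ) * a + θ)) (by linarith)
    have h3 := hgeom (1 - w * ((1 - θ) * b + θ)) (by linarith)
    have h23 := h2.mul_of_nonneg h3 (fun m => by positivity) (fun m => by positivity)
    exact h1.mul_of_nonneg h23 (fun m => by positivity) (fun m => by positivity)
  have hW0 : ∀ c, 0 ≤ W c := fun c => by positivity
  refine ⟨8 * C * (∑' c, W c) + 1, by have : 0 ≤ ∑' c, W c := tsum_nonneg hW0; positivity, ?_⟩
  intro J K e f T g h he0 hf0 he hf hg hh hT hcol hrow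
  have hdy : ∀ x : ℝ, 0 < x → x ≤ 1 →
      ∃ m : ℕ, (1 / 2 : ℝ) ^ (m + 1) < x ∧ x ≤ 2 * (1 / 2 : ℝ) ^ (m + 1) := by
    intro x h0 h1
    obtain ⟨m, hm, hm'⟩ := exists_nat_pow_near_of_lt_one h0 h1 (y := (1 / 2 : ℝ))
      (by norm_num) (by norm_num)
    exact ⟨m, hm, hm'.trans_eq (by ring)⟩
  choose! d hd1 hd2 using hdy
  have hle1 : ∀ (L : Finset ℤ) (e : ℤ → ℝ) (u : ℝ), 0 < u → (∀ j ∈ L, 0 < e j) →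
      ∑ j ∈ L, e j ^ u ≤ 1 → ∀ j ∈ L, e j ≤ 1 := by
    intro L e u hu h0 hs j hj
    by_contra! hlt
    have h1 := Finset.single_le_sum (f := fun j => e j ^ u)
      (fun i hi => Real.rpow_nonneg (h0 i hi).le _) hj
    have h2 := Real.one_lt_rpow hlt hu
    linarith
  have he1 := hle1 J e u hu0 he0 he
  have hf1 := hle1 K f w hw0 hf0 hf
  have hT1 : ∀ j ∈ J, ∀ k ∈ K, T j k ≤ 1 := by
    intro j hj k hk
    obtain ⟨hg0, hg1⟩ := hg j hj k hk
    obtain ⟨hh0, hh1⟩ := hh j hj k hk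
    exact (hT j hj k hk).trans (mul_le_one₀ (Real.rpow_le_one hh0 hh1 (by linarith [one_div_pos.2 hu0]))
      (Real.rpow_nonneg hg0 _) (Real.rpow_le_one hg0 hg1 (by linarith [one_div_pos.2 hw0])))
  set Q := (J ×ˢ K).filter (fun x => 0 < T x.1 x.2) with hQ
  set cl : ℤ × ℤ → ℕ × ℕ × ℕ := fun x => (d (T x.1 x.2), d (e x.1), d (f x.2)) with hcl
  have hQmem : ∀ x ∈ Q, x.1 ∈ J ∧ x.2 ∈ K ∧ 0 < T x.1 x.2 := by
    intro x hx
    have := Finset.mem_filter.1 hx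
    exact ⟨(Finset.mem_product.1 this.1).1, (Finset.mem_product.1 this.1).2, this.2⟩
  calc ∑ j ∈ J, ∑ k ∈ K, e j * f k * T j k = ∑ x ∈ J ×ˢ K, e x.1 * f x.2 * T x.1 x.2 := by
        rw [Finset.sum_product]
    _ ≤ ∑ x ∈ Q, e x.1 * f x.2 * T x.1 x.2 := by
        rw [hQ, Finset.sum_filter]
        refine Finset.sum_le_sum fun x hx => ?_
        obtain ⟨hj, hk⟩ := Finset.mem_product.1 hx
        split_ifs with hpos
        · exact le_rfl
        · exact mul_nonpos_of_nonneg_of_nonpos (mul_pos (he0 _ hj) (hf0 _ hk)).le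
            (not_lt.1 hpos)
    _ = ∑ c ∈ Q.image cl, ∑ x ∈ Q with cl x = c, e x.1 * f x.2 * T x.1 x.2 :=
        (Finset.sum_fiberwise_of_maps_to (fun x hx => Finset.mem_image_of_mem _ hx) _).symm
    _ ≤ ∑ c ∈ Q.image cl, 8 * C * W c := by
        refine Finset.sum_le_sum fun c _ => ?_
        have hε1 : (1 / 2 : ℝ) ^ (c.1 + 1) ≤ 1 := pow_le_one₀ (by norm_num) (by norm_num)
        have hmem : ∀ x ∈ Q.filter (fun x => cl x = c), x.1 ∈ J ∧ x.2 ∈ K ∧ 0 < T x.1 x.2 ∧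
            d (T x.1 x.2) = c.1 ∧ d (e x.1) = c.2.1 ∧ d (f x.2) = c.2.2 := by
          intro x hx
          obtain ⟨hxQ, rfl⟩ := Finset.mem_filter.1 hx
          obtain ⟨h1, h2, h3⟩ := hQmem x hxQ
          exact ⟨h1, h2, h3, rfl, rfl, rfl⟩
        have := sum_dyadic_block_le (p := p) (q := q) (u := u) (w := w) (a := a) (b := b) (θ := θ)
          (C := C) (ε := (1 / 2) ^ (c.1 + 1)) (η := (1 / 2) ^ (c.2.1 + 1))
          (δ := (1 / 2) ^ (c.2.2 + 1)) hu0 hw0 (by linarith [one_div_pos.2 hu0])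
          (by linarith [one_div_pos.2 hw0]) (by linarith) (by linarith) (by linarith) hθ0 hθ1 hC
          (by positivity) hε1 (by positivity) (by positivity) J K e f T g h
          (Q.filter (fun x => cl x = c))
          ((Finset.filter_subset _ _).trans (Finset.filter_subset _ _))
          (fun x hx => by
            obtain ⟨h1, h2, h3, h4, -, -⟩ := hmem x hx
            rw [← h4]
            exact ⟨hd1 _ h3 (hT1 _ h1 _ h2), hd2 _ h3 (hT1 _ h1 _ h2)⟩)
          (fun x hx => by
            obtain ⟨h1, h2, h3, -, h4, -⟩ := hmem x hx
            rw [← h4]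
            exact ⟨hd1 _ (he0 _ h1) (he1 _ h1), hd2 _ (he0 _ h1) (he1 _ h1)⟩)
          (fun x hx => by
            obtain ⟨h1, h2, h3, -, -, h4⟩ := hmem x hx
            rw [← h4]
            exact ⟨hd1 _ (hf0 _ h2) (hf1 _ h2), hd2 _ (hf0 _ h2) (hf1 _ h2)⟩)
          (fun j hj => (he0 j hj).le) (fun k hk => (hf0 k hk).le) he hf hg hh hT
          (fun k hk J' hJ' hJ => hcol _ _ (by positivity) hε1 (by positivity) k hk J' hJ' hJ)
          (fun j hj K' hK' hK => hrow _ _ (by positivity) hε1 (by positivity) j hj K' hK' hK)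
        exact this.trans_eq (by rw [hW]; ring)
    _ = 8 * C * ∑ c ∈ Q.image cl, W c := by rw [Finset.mul_sum]
    _ ≤ 8 * C * ∑' c, W c := by
        gcongr
        exact hWsum.sum_le_tsum _ fun c _ => hW0 c
    _ ≤ _ := by linarith

lemma Hyp2.dual {n : ℕ} {r s : ℝ}
    {S Sstar : Set (EuclideanSpace ℝ (Fin n)) → EuclideanSpace ℝ (Fin n) → ℝ≥0∞}
    (hr : 1 < r) (hrs : r < s)
    (hdual : ∀ E F : Set (EuclideanSpace ℝ (Fin n)), MeasurableSet E → MeasurableSet F →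
      (∫⁻ x in F, S E x) = ∫⁻ x in E, Sstar F x)
    (h : Hyp2 n r s S Sstar) : Hyp1 n (s / (s - 1)) (r / (r - 1)) Sstar := by
  have hr0 : r ≠ 0 := by linarith
  have hs0 : s ≠ 0 := by linarith
  have hr1 : r - 1 ≠ 0 := by linarith
  have hs1 : s - 1 ≠ 0 := by linarith
  have hsr : s - r ≠ 0 := by linarith
  have hconj : ∀ t : ℝ, t - 1 ≠ 0 → t / (t - 1) / (t / (t - 1) - 1) = t := by
    intro t ht
    have : t / (t - 1) - 1 = 1 / (t - 1) := by field_simp; ring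
    rw [this]
    field_simp
  obtain ⟨V, C, hC, hV, H⟩ := h
  refine ⟨V.image fun v => (v.2.2.1, v.2.2.2, v.1, v.2.1), C, hC, ?_, ?_⟩
  · intro u hu
    obtain ⟨v, hv, rfl⟩ := Finset.mem_image.1 hu
    obtain ⟨h1, h2, h3⟩ := hV v hv
    rw [hconj s hs1, hconj r hr1]
    exact ⟨h2, h1, h3⟩
  · intro E₁ E₂ F hE₁ hE₂ hF p₁ f₁ p₂ f₂ p f α₁ α₂ β₁ β₂ hα hα' hβ hβ' hS₁ hS₂ hT₁ hT₂
    rw [calS, ← hdual F E₁ hF hE₁] at hT₁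
    rw [calS, ← hdual F E₂ hF hE₂] at hT₂
    obtain ⟨v, hv, hle⟩ := H F E₁ E₂ hF hE₁ hE₂ p f p₁ f₁ p₂ f₂ β₁ β₂ α₁ α₂ hβ hβ' hα hα' hS₁ hS₂
      hT₁ hT₂
    refine ⟨_, Finset.mem_image_of_mem _ hv, ?_⟩
    convert hle using 2
    ring

/-- The restricted bound localizes to the level sets of `S E` in `F` and of `Sstar F` in `E`. -/
lemma le_of_restricted_bound_level_sets {n : ℕ} {p q : ℝ}
    {S Sstar : Set (EuclideanSpace ℝ (Fin n)) → EuclideanSpace ℝ (Fin n) → ℝ≥0∞}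
    (hSmeas : ∀ E : Set (EuclideanSpace ℝ (Fin n)), MeasurableSet E → Measurable (S E))
    (hSstarmeas : ∀ F : Set (EuclideanSpace ℝ (Fin n)), MeasurableSet F → Measurable (Sstar F))
    (hdual : ∀ E F : Set (EuclideanSpace ℝ (Fin n)), MeasurableSet E → MeasurableSet F →
      (∫⁻ x in F, S E x) = ∫⁻ x in E, Sstar F x)
    {C : ℝ} (hC : 0 < C)
    (hbd : ∀ E F : Set (EuclideanSpace ℝ (Fin n)), PosFinite volume E → PosFinite volume F →
      calS n S E F ≤ ENNReal.ofReal (C * (volume.real E ^ p * volume.real F ^ q)))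
    {E F : Set (EuclideanSpace ℝ (Fin n))} (hE : PosFinite volume E) (hF : PosFinite volume F)
    {Q : ℝ} (hQ : 0 ≤ Q) (hQS : calS n S E F = ENNReal.ofReal Q) :
    Q ≤ 2 * C *
      (volume.real (E ∩ {x | ENNReal.ofReal (Q / (4 * volume.real E)) ≤ Sstar F x}) ^ p *
      volume.real (F ∩ {x | ENNReal.ofReal (Q / (4 * volume.real F)) ≤ S E x}) ^ q) := by
  have hGm : MeasurableSet {x | ENNReal.ofReal (Q / (4 * volume.real F)) ≤ S E x} :=
    measurableSet_le measurable_const (hSmeas E hE.1)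
  have hHm : MeasurableSet {x | ENNReal.ofReal (Q / (4 * volume.real E)) ≤ Sstar F x} :=
    measurableSet_le measurable_const (hSstarmeas F hF.1)
  have hstep : ∀ A : Set (EuclideanSpace ℝ (Fin n)), PosFinite volume A →
      ENNReal.ofReal (Q / (4 * volume.real A)) * volume A = ENNReal.ofReal (Q / 4) := by
    intro A hA
    have := hA.real_pos
    rw [← ofReal_measureReal hA.3.ne, ← ENNReal.ofReal_mul (by positivity)]
    congr 1
    field_simp
  set G := F ∩ {x | ENNReal.ofReal (Q / (4 * volume.real F)) ≤ S E x} with hG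
  set H := E ∩ {x | ENNReal.ofReal (Q / (4 * volume.real E)) ≤ Sstar F x} with hH
  have hGmeas : MeasurableSet G := hF.1.inter hGm
  have hHmeas : MeasurableSet H := hE.1.inter hHm
  have h1 : calS n S E F ≤ calS n S E G + ENNReal.ofReal (Q / 4) := by
    rw [← hstep F hF]
    exact setLIntegral_le_level_add (hSmeas E hE.1) F _
  have h2 : calS n S E G ≤ calS n S H G + ENNReal.ofReal (Q / 4) := by
    have hEH : MeasurableSet (E \ {x | ENNReal.ofReal (Q / (4 * volume.real E)) ≤ Sstar F x}) :=
      hE.1.diff hHm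
    calc calS n S E G = ∫⁻ x in E, Sstar G x := hdual E G hE.1 hGmeas
      _ = (∫⁻ x in H, Sstar G x) +
          ∫⁻ x in E \ {x | ENNReal.ofReal (Q / (4 * volume.real E)) ≤ Sstar F x}, Sstar G x :=
          (lintegral_inter_add_sdiff _ _ hHm).symm
      _ ≤ calS n S H G + ENNReal.ofReal (Q / 4) := by
          refine add_le_add (hdual H G hHmeas hGmeas).ge ?_
          rw [← hdual _ _ hEH hGmeas]
          refine (lintegral_mono_set inter_subset_left).trans ?_
          rw [hdual _ _ hEH hF.1, ← hstep E hE]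
          calc _ ≤ ∫⁻ _ in E \ {x | ENNReal.ofReal (Q / (4 * volume.real E)) ≤ Sstar F x},
                ENNReal.ofReal (Q / (4 * volume.real E)) :=
                setLIntegral_mono measurable_const fun x hx => (not_le.1 hx.2).le
            _ ≤ _ := by
                rw [setLIntegral_const]
                gcongr
                exact sdiff_subset
  have h3 : ENNReal.ofReal (Q / 2) ≤ calS n S H G := by
    have h := h1.trans (add_le_add h2 le_rfl)
    rw [hQS, add_assoc, ← ENNReal.ofReal_add (by positivity) (by positivity),
      show Q / 4 + Q / 4 = Q / 2 by ring] at h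
    nth_rewrite 1 [show Q = Q / 2 + Q / 2 by ring] at h
    rw [ENNReal.ofReal_add (by positivity) (by positivity)] at h
    exact (ENNReal.add_le_add_iff_right ENNReal.ofReal_ne_top).1 h
  have hnn : 0 ≤ 2 * C * (volume.real H ^ p * volume.real G ^ q) := by positivity
  by_cases hG0 : volume G = 0
  · rw [calS, setLIntegral_measure_zero _ _ hG0, nonpos_iff_eq_zero, ENNReal.ofReal_eq_zero] at h3
    linarith
  by_cases hH0 : volume H = 0
  · rw [calS, hdual H G hHmeas hGmeas, setLIntegral_measure_zero _ _ hH0, nonpos_iff_eq_zero,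
      ENNReal.ofReal_eq_zero] at h3
    linarith
  have h4 := h3.trans (hbd H G
    ⟨hHmeas, pos_iff_ne_zero.2 hH0, (measure_mono inter_subset_left).trans_lt hE.3⟩
    ⟨hGmeas, pos_iff_ne_zero.2 hG0, (measure_mono inter_subset_left).trans_lt hF.3⟩)
  rw [ENNReal.ofReal_le_ofReal_iff (by positivity)] at h4
  linarith

lemma mul_rpow_le_of_lt_div {C x y Q p q ε : ℝ} (hC : 2 ≤ C) (hx : 0 < x) (hy : 0 < y)
    (hε : 0 < ε) (h : ε < Q / (2 * C * (x ^ p * y ^ q))) :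
    ε * (x ^ p * y ^ (q - 1)) ≤ Q / (4 * y) := by
  have hC0 : 0 < C := by linarith
  rw [lt_div_iff₀ (by positivity)] at h
  rw [le_div_iff₀ (by positivity), Real.rpow_sub_one hy.ne']
  have h1 : 0 ≤ (C - 2) * (ε * (x ^ p * y ^ q)) :=
    mul_nonneg (by linarith) (by positivity)
  calc ε * (x ^ p * (y ^ q / y)) * (4 * y) = 4 * (ε * (x ^ p * y ^ q)) := by field_simp
    _ ≤ Q := by linarith

lemma rpow_inv_le_of_lt_mul {h g p q ε : ℝ} (hp : 0 ≤ p) (hq : 0 < q) (hε : 0 < ε)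
    (hh0 : 0 ≤ h) (hh1 : h ≤ 1) (hg0 : 0 ≤ g) (hlt : ε < h ^ p * g ^ q) : ε ^ (1 / q) ≤ g := by
  have h1 : ε ≤ g ^ q :=
    hlt.le.trans (mul_le_of_le_one_left (Real.rpow_nonneg hg0 _) (Real.rpow_le_one hh0 hh1 hp))
  calc ε ^ (1 / q) ≤ (g ^ q) ^ (1 / q) := by gcongr
    _ = g := by rw [← Real.rpow_mul hg0, mul_one_div_cancel hq.ne', Real.rpow_one]

lemma sum_div_rpow_le_one {L : Finset ℤ} (hL : L.Nonempty) {a : ℤ → ℝ} {u : ℝ} (hu : 0 < u)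
    (ha : ∀ j ∈ L, 0 < a j) : 0 < (∑ j ∈ L, a j ^ u) ^ (1 / u) ∧
      ∑ j ∈ L, (a j / (∑ j ∈ L, a j ^ u) ^ (1 / u)) ^ u ≤ 1 := by
  have hpos : 0 < ∑ j ∈ L, a j ^ u :=
    Finset.sum_pos (fun j hj => Real.rpow_pos_of_pos (ha j hj) _) hL
  have hA : 0 < (∑ j ∈ L, a j ^ u) ^ (1 / u) := Real.rpow_pos_of_pos hpos _
  refine ⟨hA, le_of_eq ?_⟩
  have : ((∑ j ∈ L, a j ^ u) ^ (1 / u)) ^ u = ∑ j ∈ L, a j ^ u := by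
    rw [← Real.rpow_mul hpos.le, one_div_mul_cancel hu.ne', Real.rpow_one]
  calc _ = ∑ j ∈ L, a j ^ u / ∑ j ∈ L, a j ^ u :=
        Finset.sum_congr rfl fun j hj => by rw [Real.div_rpow (ha j hj).le hA.le, this]
    _ = 1 := by rw [← Finset.sum_div, div_self hpos.ne']

lemma two_zpow_eq_ofReal (j : ℤ) : (2 : ℝ≥0∞) ^ j = ENNReal.ofReal ((2 : ℝ) ^ j) := by
  rw [← ENNReal.rpow_intCast, ← Real.rpow_intCast, ← ENNReal.ofReal_rpow_of_pos two_pos,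
    ENNReal.ofReal_ofNat]

lemma PosFinite.ofReal_weighted_norm {X : Type*} [MeasurableSpace X] {μ : Measure X}
    {L : Finset ℤ} {E : ℤ → Set X} (hE : ∀ j ∈ L, PosFinite μ (E j)) {u p t : ℝ} (hu : 0 < u)
    (ht : t = u * p) {u' : ℝ} (hu' : u' = 1 / u) :
    (∑ j ∈ L, ((2 : ℝ≥0∞) ^ j) ^ u * μ (E j) ^ t) ^ u' =
      ENNReal.ofReal ((∑ j ∈ L, ((2 : ℝ) ^ j * μ.real (E j) ^ p) ^ u) ^ (1 / u)) := by
  have h0 : ∀ j ∈ L, 0 ≤ ((2 : ℝ) ^ j * μ.real (E j) ^ p) ^ u := fun j hj => by positivity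
  subst ht hu'
  rw [← ENNReal.ofReal_rpow_of_nonneg (Finset.sum_nonneg h0) (by positivity),
    ENNReal.ofReal_sum_of_nonneg h0]
  congr 1
  refine Finset.sum_congr rfl fun j hj => ?_
  have hx := (hE j hj).real_pos
  rw [Real.mul_rpow (by positivity) (by positivity), ← Real.rpow_mul hx.le, mul_comm p,
    ENNReal.ofReal_mul (by positivity), ← ENNReal.ofReal_rpow_of_pos (by positivity),
    ← ENNReal.ofReal_rpow_of_pos hx, ofReal_measureReal (hE j hj).3.ne, two_zpow_eq_ofReal]

/-- Theorem `wktost`: under Hypotheses 1 and 2, `S` is bounded from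
`L^{r,u}` to `L^{s,v}` for `r ≤ u < v ≤ s`, in bilinear discretized form;
here `v' = v/(v-1)` and `s' = s/(s-1)`. -/
theorem abstract_lorentz_bound (n : ℕ) (hn : 1 ≤ n) (r s : ℝ) (hr : 1 < r) (hrs : r < s)
    (S Sstar : Set (EuclideanSpace ℝ (Fin n)) → EuclideanSpace ℝ (Fin n) → ℝ≥0∞)
    (hSmeas : ∀ E : Set (EuclideanSpace ℝ (Fin n)), MeasurableSet E → Measurable (S E))
    (hSstarmeas : ∀ F : Set (EuclideanSpace ℝ (Fin n)), MeasurableSet F →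
      Measurable (Sstar F))
    (hdual : ∀ E F : Set (EuclideanSpace ℝ (Fin n)), MeasurableSet E → MeasurableSet F →
      (∫⁻ x in F, S E x) = ∫⁻ x in E, Sstar F x)
    (h1 : Hyp1 n r s S) (h2 : Hyp2 n r s S Sstar)
    (u v : ℝ) (hru : r ≤ u) (huv : u < v) (hvs : v ≤ s) :
    ∃ C : ℝ, 0 < C ∧
      ∀ (J K : Finset ℤ) (E F : ℤ → Set (EuclideanSpace ℝ (Fin n))),
        (∀ j ∈ J, MeasurableSet (E j)) → (J : Set ℤ).PairwiseDisjoint E →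
        (∀ j ∈ J, 0 < volume (E j)) → (∀ j ∈ J, volume (E j) < ∞) →
        (∀ k ∈ K, MeasurableSet (F k)) → (K : Set ℤ).PairwiseDisjoint F →
        (∀ k ∈ K, 0 < volume (F k)) → (∀ k ∈ K, volume (F k) < ∞) →
        ∑ j ∈ J, ∑ k ∈ K, (2 : ℝ≥0∞) ^ j * (2 : ℝ≥0∞) ^ k * calS n S (E j) (F k) ≤
          ENNReal.ofReal C *
            (∑ j ∈ J, ((2 : ℝ≥0∞) ^ j) ^ u * volume (E j) ^ (u / r)) ^ (1 / u) *
            (∑ k ∈ K, ((2 : ℝ≥0∞) ^ k) ^ (v / (v - 1)) *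
              volume (F k) ^ ((v / (v - 1)) * (1 - 1 / s))) ^ ((v - 1) / v) := by
  have hr0 : 0 < r := by linarith
  have hs0 : 0 < s := by linarith
  have hu0 : 0 < u := by linarith
  have hv0 : 0 < v := by linarith
  have hv1 : 0 < v - 1 := by linarith
  have hs1 : 0 < s - 1 := by linarith
  have hr1 : 0 < r - 1 := by linarith
  have hsr : 0 < s - r := by linarith
  have hq0 : 0 < 1 - 1 / s := by rw [sub_pos, div_lt_one hs0]; linarith
  set w := v / (v - 1) with hw_def
  have hw0 : 0 < w := by positivity
  have hw1 : 1 ≤ w := by rw [hw_def, one_le_div hv1]; linarith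
  have hwinv : 1 / w = 1 - 1 / v := by rw [hw_def]; field_simp
  obtain ⟨C₀, hC₀, hbd₀⟩ := h1.exists_restricted_bound hr hrs hSmeas
  set C₁ := C₀ + 2 with hC₁
  have hC₁2 : 2 ≤ C₁ := by linarith
  have hbd : ∀ E F : Set (EuclideanSpace ℝ (Fin n)), PosFinite volume E → PosFinite volume F →
      calS n S E F ≤
        ENNReal.ofReal (C₁ * (volume.real E ^ (1 / r) * volume.real F ^ (1 - 1 / s))) :=
    fun E F hE hF => (hbd₀ E F hE hF).trans (ENNReal.ofReal_le_ofReal (by gcongr; linarith))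
  obtain ⟨τ, hτ, hsum⟩ := exists_bilinear_sum_bound (p := 1 / r) (q := 1 - 1 / s) (u := u) (w := w)
    (by linarith) hw1 (one_div_le_one_div_of_le hr0 hru)
    (by rw [hwinv]; linarith [one_div_le_one_div_of_le hv0 hvs])
    (by rw [hwinv]; linarith [one_div_lt_one_div_of_lt hu0 huv])
  obtain ⟨Ca, hCa, hcol⟩ := h1.exists_sum_level_sets_bound hr hrs (q := 1 / (1 - 1 / s))
    (by positivity) hτ
  have hs' : 1 < s / (s - 1) := by rw [one_lt_div hs1]; linarith
  have hsr' : s / (s - 1) < r / (r - 1) := by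
    rw [div_lt_div_iff₀ hs1 hr1]; linarith
  obtain ⟨Cb, hCb, hrow⟩ := (h2.dual hr hrs hdual).exists_sum_level_sets_bound hs' hsr'
    (q := 1 / (1 / r)) (by positivity) hτ
  have hconj_s : 1 / (s / (s - 1)) = 1 - 1 / s := by field_simp
  have hconj_r : -(1 / (r / (r - 1))) = 1 / r - 1 := by field_simp; ring
  have hneg_s : -(1 / s) = 1 - 1 / s - 1 := by ring
  simp only [hconj_s, hconj_r] at hrow
  simp only [hneg_s] at hcol
  set Cm := max 1 (max Ca Cb) with hCm
  obtain ⟨B₀, hB₀, hfinal⟩ := hsum Cm (le_max_left _ _)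
  refine ⟨2 * C₁ * B₀, by positivity, ?_⟩
  intro J K E F hEm _ hE0 hEt hFm _ hF0 hFt
  have hE : ∀ j ∈ J, PosFinite volume (E j) := fun j hj => ⟨hEm j hj, hE0 j hj, hEt j hj⟩
  have hF : ∀ k ∈ K, PosFinite volume (F k) := fun k hk => ⟨hFm k hk, hF0 k hk, hFt k hk⟩
  rcases J.eq_empty_or_nonempty with rfl | hJne
  · simp
  rcases K.eq_empty_or_nonempty with rfl | hKne
  · simp
  set α : ℤ → ℝ := fun j => (2 : ℝ) ^ j * volume.real (E j) ^ (1 / r) with hα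
  set β : ℤ → ℝ := fun k => (2 : ℝ) ^ k * volume.real (F k) ^ (1 - 1 / s) with hβ
  have hα0 : ∀ j ∈ J, 0 < α j := fun j hj => by have := (hE j hj).real_pos; positivity
  have hβ0 : ∀ k ∈ K, 0 < β k := fun k hk => by have := (hF k hk).real_pos; positivity
  obtain ⟨hA0, hA1⟩ := sum_div_rpow_le_one hJne hu0 hα0
  obtain ⟨hB0, hB1⟩ := sum_div_rpow_le_one hKne hw0 hβ0
  rw [PosFinite.ofReal_weighted_norm hE hu0 (p := 1 / r) (by ring) rfl,
    PosFinite.ofReal_weighted_norm hF hw0 (p := 1 - 1 / s) rfl (by rw [hw_def, one_div_div])]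
  set A := (∑ j ∈ J, α j ^ u) ^ (1 / u) with hA
  set B := (∑ k ∈ K, β k ^ w) ^ (1 / w) with hB
  set Q : ℤ → ℤ → ℝ := fun j k => (calS n S (E j) (F k)).toReal with hQ
  have hQS : ∀ j ∈ J, ∀ k ∈ K, calS n S (E j) (F k) = ENNReal.ofReal (Q j k) := fun j hj k hk =>
    (ENNReal.ofReal_toReal ((hbd _ _ (hE j hj) (hF k hk)).trans_lt ENNReal.ofReal_lt_top).ne).symm
  have hQ0 : ∀ j k, 0 ≤ Q j k := fun j k => ENNReal.toReal_nonneg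
  set G : ℤ → ℤ → Set (EuclideanSpace ℝ (Fin n)) := fun j k =>
    F k ∩ {x | ENNReal.ofReal (Q j k / (4 * volume.real (F k))) ≤ S (E j) x} with hG
  set H : ℤ → ℤ → Set (EuclideanSpace ℝ (Fin n)) := fun j k =>
    E j ∩ {x | ENNReal.ofReal (Q j k / (4 * volume.real (E j))) ≤ Sstar (F k) x} with hH
  set T : ℤ → ℤ → ℝ := fun j k =>
    Q j k / (2 * C₁ * (volume.real (E j) ^ (1 / r) * volume.real (F k) ^ (1 - 1 / s))) with hT
  set g : ℤ → ℤ → ℝ := fun j k => volume.real (G j k) / volume.real (F k) with hg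
  set h : ℤ → ℤ → ℝ := fun j k => volume.real (H j k) / volume.real (E j) with hh
  have hg01 : ∀ j ∈ J, ∀ k ∈ K, 0 ≤ g j k ∧ g j k ≤ 1 := fun j hj k hk =>
    ⟨by positivity, (div_le_one (hF k hk).real_pos).2
      (measureReal_mono inter_subset_left (hF k hk).3.ne)⟩
  have hh01 : ∀ j ∈ J, ∀ k ∈ K, 0 ≤ h j k ∧ h j k ≤ 1 := fun j hj k hk =>
    ⟨by positivity, (div_le_one (hE j hj).real_pos).2
      (measureReal_mono inter_subset_left (hE j hj).3.ne)⟩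
  have hTle : ∀ j ∈ J, ∀ k ∈ K, T j k ≤ h j k ^ (1 / r) * g j k ^ (1 - 1 / s) := by
    intro j hj k hk
    have hx := (hE j hj).real_pos
    have hy := (hF k hk).real_pos
    rw [hT, hh, hg]
    simp only
    rw [div_le_iff₀ (by positivity), Real.div_rpow measureReal_nonneg hx.le,
      Real.div_rpow measureReal_nonneg hy.le]
    refine (le_of_restricted_bound_level_sets hSmeas hSstarmeas hdual (by positivity) hbd
      (hE j hj) (hF k hk) (hQ0 j k) (hQS j hj k hk)).trans_eq ?_
    field_simp
    rfl
  have hGm : ∀ j ∈ J, ∀ k ∈ K, MeasurableSet (G j k) := fun j hj k hk =>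
    (hFm k hk).inter (measurableSet_le measurable_const (hSmeas _ (hEm j hj)))
  have hHm : ∀ j ∈ J, ∀ k ∈ K, MeasurableSet (H j k) := fun j hj k hk =>
    (hEm j hj).inter (measurableSet_le measurable_const (hSstarmeas _ (hFm k hk)))
  have hreal : ∑ j ∈ J, ∑ k ∈ K, α j / A * (β k / B) * T j k ≤ B₀ := by
    refine hfinal J K _ _ T g h (fun j hj => div_pos (hα0 j hj) hA0)
      (fun k hk => div_pos (hβ0 k hk) hB0) hA1 hB1 hg01 hh01 hTle ?_ ?_
    · intro ε η hε hε1 hη k hk J' hJ' hmem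
      have hy := (hF k hk).real_pos
      rw [hg]
      simp only
      rw [← Finset.sum_div, div_le_iff₀ hy]
      refine (hcol ε (η * A) hε hε1 (by positivity) (F k) (hF k hk) J' E (fun j => G j k)
        (fun j hj => hE j (hJ' hj)) (fun j hj => hGm j (hJ' hj) k hk)
        (fun j hj => inter_subset_left) ?_ ?_ ?_).trans ?_
      · intro j hj x hx
        exact (ENNReal.ofReal_le_ofReal (mul_rpow_le_of_lt_div hC₁2 (hE j (hJ' hj)).real_pos hy hε
          (hmem j hj).1)).trans hx.2
      · intro j hj
        rw [← le_div_iff₀ hy]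
        exact rpow_inv_le_of_lt_mul (by positivity) hq0 hε (hh01 j (hJ' hj) k hk).1
          (hh01 j (hJ' hj) k hk).2 (hg01 j (hJ' hj) k hk).1
          ((hmem j hj).1.trans_le (hTle j (hJ' hj) k hk))
      · intro j hj
        obtain ⟨-, -, h3, h4⟩ := hmem j hj
        rw [lt_div_iff₀ hA0] at h3
        rw [div_le_iff₀ hA0] at h4
        exact ⟨h3, h4.trans_eq (by ring)⟩
      · gcongr
        exact (le_max_left _ _).trans (le_max_right _ _)
    · intro ε η hε hε1 hη j hj K' hK' hmem
      have hx := (hE j hj).real_pos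
      rw [hh]
      simp only
      rw [← Finset.sum_div, div_le_iff₀ hx]
      refine (hrow ε (η * B) hε hε1 (by positivity) (E j) (hE j hj) K' F (fun k => H j k)
        (fun k hk => hF k (hK' hk)) (fun k hk => hHm j hj k (hK' hk))
        (fun k hk => inter_subset_left) ?_ ?_ ?_).trans ?_
      · intro k hk x hx'
        refine (ENNReal.ofReal_le_ofReal (mul_rpow_le_of_lt_div hC₁2 (hF k (hK' hk)).real_pos hx hε
          ?_)).trans hx'.2
        rw [mul_comm (volume.real (F k) ^ _)]
        exact (hmem k hk).1
      · intro k hk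
        rw [← le_div_iff₀ hx]
        refine rpow_inv_le_of_lt_mul hq0.le (by positivity) hε (hg01 j hj k (hK' hk)).1
          (hg01 j hj k (hK' hk)).2 (hh01 j hj k (hK' hk)).1 ?_
        rw [mul_comm]
        exact (hmem k hk).1.trans_le (hTle j hj k (hK' hk))
      · intro k hk
        obtain ⟨-, -, h3, h4⟩ := hmem k hk
        rw [lt_div_iff₀ hB0] at h3
        rw [div_le_iff₀ hB0] at h4
        exact ⟨h3, h4.trans_eq (by ring)⟩
      · gcongr
        exact (le_max_right _ _).trans (le_max_right _ _)
  have hlhs : ∑ j ∈ J, ∑ k ∈ K, (2 : ℝ≥0∞) ^ j * (2 : ℝ≥0∞) ^ k * calS n S (E j) (F k) =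
      ENNReal.ofReal (2 * C₁ * A * B * ∑ j ∈ J, ∑ k ∈ K, α j / A * (β k / B) * T j k) := by
    have hterm : ∀ j ∈ J, ∀ k ∈ K, 2 * C₁ * A * B * (α j / A * (β k / B) * T j k) =
        (2 : ℝ) ^ j * (2 : ℝ) ^ k * Q j k := by
      intro j hj k hk
      have hx := (hE j hj).real_pos
      have hy := (hF k hk).real_pos
      rw [hα, hβ, hT]
      field_simp
    rw [Finset.mul_sum, ENNReal.ofReal_sum_of_nonneg]
    · refine Finset.sum_congr rfl fun j hj => ?_
      rw [Finset.mul_sum, ENNReal.ofReal_sum_of_nonneg]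
      · refine Finset.sum_congr rfl fun k hk => ?_
        rw [hterm j hj k hk, hQS j hj k hk, ENNReal.ofReal_mul (by positivity),
          ENNReal.ofReal_mul (by positivity), two_zpow_eq_ofReal, two_zpow_eq_ofReal]
      · intro k hk
        rw [hterm j hj k hk]
        have := hQ0 j k
        positivity
    · intro j hj
      rw [Finset.mul_sum]
      refine Finset.sum_nonneg fun k hk => ?_
      rw [hterm j hj k hk]
      have := hQ0 j k
      positivity
  rw [hlhs, ← ENNReal.ofReal_mul (by positivity), ← ENNReal.ofReal_mul (by positivity)]
  refine ENNReal.ofReal_le_ofReal ?_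
  calc 2 * C₁ * A * B * ∑ j ∈ J, ∑ k ∈ K, α j / A * (β k / B) * T j k
      ≤ 2 * C₁ * A * B * B₀ := by gcongr
    _ = _ := by ring
end

section
/- In the setting of the abstract operator S below, assume Hypothesis 1 holds. Then there exist constants A ≥ 1 and C such that the following holds. Let F ⊆ ℝⁿ be a Borel set with 0 < |F| < ∞, let 0 < ε ≤ 1 and 0 < η ≤ 1, and let J ⊂ ℤ be a finite set such that |j − k| ≥ A(1 + log(1/ε)) for all distinct j, k ∈ J. Suppose (E_j)_{j∈J} are Borel sets of positive finite measure satisfying, for each j ∈ J, (ε/2) |E_j|^{1/r} |F|^{1/s′} < 𝒮(E_j, F) ≤ ε |E_j|^{1/r} |F|^{1/s′} and η/2 < 2^{jr} |E_j| ≤ η. Define G_j = { x ∈ F : S_{E_j}(x) ≥ 𝒮(E_j,F)/(2|F|) }. Then ∑_{j∈J} |G_j| ≤ C |F|. -/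
open MeasureTheory Set
open scoped ENNReal

lemma exists_pos_le_of_forall_pos {ι : Type*} (U : Finset ι) (f : ι → ℝ)
    (h : ∀ u ∈ U, 0 < f u) : ∃ δ : ℝ, 0 < δ ∧ ∀ u ∈ U, δ ≤ f u := by
  rcases U.eq_empty_or_nonempty with rfl | hne
  · exact ⟨1, one_pos, by simp⟩
  · obtain ⟨u, hu, hmin⟩ := U.exists_min_image f hne
    exact ⟨f u, h u hu, hmin⟩

lemma rpow_eq_ofReal_toReal_rpow {x : ℝ≥0∞} (h0 : 0 < x) (ht : x < ∞) (p : ℝ) :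
    x ^ p = ENNReal.ofReal (x.toReal ^ p) := by
  rw [← ENNReal.ofReal_rpow_of_pos (ENNReal.toReal_pos h0.ne' ht.ne),
    ENNReal.ofReal_toReal ht.ne]

/-- The logarithmic form of Hypothesis 1 for `α_j = a |E_j|^{1/r}` and
`β_j = b |E_j|^{1/r-1}`. -/
def LogHyp (n : ℕ) (r s δ K : ℝ)
    (S : Set (EuclideanSpace ℝ (Fin n)) → EuclideanSpace ℝ (Fin n) → ℝ≥0∞) : Prop :=
  ∀ E₁ E₂ F : Set (EuclideanSpace ℝ (Fin n)),
    MeasurableSet E₁ → MeasurableSet E₂ → MeasurableSet F →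
    0 < volume E₁ → volume E₁ < ∞ → 0 < volume E₂ → volume E₂ < ∞ →
    0 < volume F → volume F < ∞ → volume E₁ ≤ volume E₂ →
    ∀ a b : ℝ, 0 < a → 0 < b →
    (∀ x ∈ F, ENNReal.ofReal (a * volume.real E₁ ^ (1 / r)) ≤ S E₁ x) →
    (∀ x ∈ F, ENNReal.ofReal (a * volume.real E₂ ^ (1 / r)) ≤ S E₂ x) →
    ENNReal.ofReal (b * volume.real E₁ ^ (1 / r)) ≤ calS n S E₁ F →
    ENNReal.ofReal (b * volume.real E₂ ^ (1 / r)) ≤ calS n S E₂ F →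
    (s - 1) * Real.log a + Real.log b
      + δ * (Real.log (volume.real E₂) - Real.log (volume.real E₁)) ≤ K

lemma Hyp1.exists_logHyp {n : ℕ} {r s : ℝ} (hr : 1 < r) (hrs : r < s)
    {S : Set (EuclideanSpace ℝ (Fin n)) → EuclideanSpace ℝ (Fin n) → ℝ≥0∞}
    (h1 : Hyp1 n r s S) : ∃ δ K : ℝ, 0 < δ ∧ LogHyp n r s δ K S := by
  obtain ⟨U, C, hC, hU, H⟩ := h1
  obtain ⟨d, hd, hdU⟩ := exists_pos_le_of_forall_pos U
    (fun u => u.2.1 / r - u.2.2.2 / (r / (r - 1)) - 1) (fun u hu => (hU u hu).2.2)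
  have hr0 : 0 < r := by linarith
  have hsr : 0 < s - r := by linarith
  have hc : 0 < (s - r) / r := by positivity
  refine ⟨d * ((s - r) / r), Real.log C * ((s - r) / r), by positivity, ?_⟩
  intro E₁ E₂ F mE₁ mE₂ mF hE₁ hE₁' hE₂ hE₂' hF hF' hle a b ha hb hα₁ hα₂ hβ₁ hβ₂
  set e₁ := volume.real E₁ with he₁
  set e₂ := volume.real E₂ with he₂
  have pe₁ : 0 < e₁ := ENNReal.toReal_pos hE₁.ne' hE₁'.ne
  have pe₂ : 0 < e₂ := ENNReal.toReal_pos hE₂.ne' hE₂'.ne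
  have hee : e₁ ≤ e₂ := ENNReal.toReal_mono hE₂'.ne hle
  have v₁ : volume E₁ = ENNReal.ofReal e₁ := (ENNReal.ofReal_toReal hE₁'.ne).symm
  have v₂ : volume E₂ = ENNReal.ofReal e₂ := (ENNReal.ofReal_toReal hE₂'.ne).symm
  have hrinv : 1 / r - 1 ≤ 0 := by
    rw [sub_nonpos, div_le_one hr0]; exact hr.le
  have hβ : ∀ e : ℝ, 0 < e → b * e ^ (1 / r - 1) * e = b * e ^ (1 / r) := by
    intro e he
    rw [mul_assoc, Real.rpow_sub_one he.ne', div_mul_cancel₀ _ he.ne']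
  obtain ⟨u, hu, hineq⟩ := H E₁ E₂ F mE₁ mE₂ mF hE₁ hE₁' hE₂ hE₂' hF hF'
    (a * e₁ ^ (1 / r)) (a * e₂ ^ (1 / r)) (b * e₁ ^ (1 / r - 1)) (b * e₂ ^ (1 / r - 1))
    (by positivity)
    (mul_le_mul_of_nonneg_left (Real.rpow_le_rpow pe₁.le hee (by positivity)) ha.le)
    (by positivity)
    (mul_le_mul_of_nonneg_left (Real.rpow_le_rpow_of_nonpos pe₁ hee hrinv) hb.le)
    hα₁ hα₂
    (by rwa [v₁, ← ENNReal.ofReal_mul (by positivity), hβ e₁ pe₁])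
    (by rwa [v₂, ← ENNReal.ofReal_mul (by positivity), hβ e₂ pe₂])
  rw [v₂, ← ENNReal.ofReal_mul hC.le, ENNReal.ofReal_le_ofReal_iff (by positivity)] at hineq
  have hlog := Real.log_le_log (by positivity) hineq
  obtain ⟨hs₁, hs₂, -⟩ := hU u hu
  have hdu := hdU u hu
  obtain ⟨u₁, u₂, u₃, u₄⟩ := u
  simp only at hlog hs₁ hs₂ hdu
  rw [Real.log_mul (by positivity) (by positivity), Real.log_mul (by positivity) (by positivity),
    Real.log_mul (by positivity) (by positivity), Real.log_mul hC.ne' pe₂.ne',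
    Real.log_rpow (by positivity), Real.log_rpow (by positivity),
    Real.log_rpow (by positivity), Real.log_rpow (by positivity),
    Real.log_mul ha.ne' (by positivity), Real.log_mul ha.ne' (by positivity),
    Real.log_mul hb.ne' (by positivity), Real.log_mul hb.ne' (by positivity),
    Real.log_rpow pe₁, Real.log_rpow pe₂, Real.log_rpow pe₁, Real.log_rpow pe₂] at hlog
  have hx : 0 ≤ Real.log e₂ - Real.log e₁ := sub_nonneg.2 (Real.log_le_log pe₁ hee)
  have hr1 : r - 1 ≠ 0 := by linarith
  have hs₁' : u₁ = r * (s - 1) / (s - r) - u₂ := by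
    have hs1 : s - 1 ≠ 0 := by linarith
    have h : r / (r - 1) - s / (s - 1) = (s - r) / ((r - 1) * (s - 1)) := by
      field_simp; ring
    rw [h] at hs₁
    rw [eq_sub_iff_add_eq, hs₁]
    field_simp
  have hs₂' : u₃ = r / (s - r) - u₄ := by linarith
  have key : (s - 1) * Real.log a + Real.log b
      + (u₂ / r - u₄ / (r / (r - 1)) - 1) * ((s - r) / r) * (Real.log e₂ - Real.log e₁)
      ≤ Real.log C * ((s - r) / r) := by
    have := mul_le_mul_of_nonneg_right hlog hc.le
    rw [hs₁', hs₂'] at this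
    refine le_of_sub_nonneg ((sub_nonneg.2 this).trans_eq ?_)
    field_simp
    ring
  have := mul_le_mul_of_nonneg_right (mul_le_mul_of_nonneg_right hdu hc.le) hx
  linarith

section Superlevel

variable {n : ℕ} {S : Set (EuclideanSpace ℝ (Fin n)) → EuclideanSpace ℝ (Fin n) → ℝ≥0∞}
  {E F : Set (EuclideanSpace ℝ (Fin n))}

lemma calS_le_calS_superlevel_add (hS : Measurable (S E)) (τ : ℝ≥0∞) :
    calS n S E F ≤ calS n S E {x ∈ F | τ ≤ S E x} + τ * volume F := by
  have hG : MeasurableSet {x | τ ≤ S E x} := measurableSet_le measurable_const hS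
  unfold calS
  rw [← lintegral_inter_add_sdiff (S E) F hG]
  refine add_le_add le_rfl ?_
  calc ∫⁻ x in F \ {x | τ ≤ S E x}, S E x
      ≤ ∫⁻ _ in F \ {x | τ ≤ S E x}, τ :=
        setLIntegral_mono measurable_const fun x hx => (not_le.1 hx.2).le
    _ = τ * volume (F \ {x | τ ≤ S E x}) := setLIntegral_const _ _
    _ ≤ τ * volume F := by gcongr; exact sdiff_subset

lemma mul_volume_le_calS (hF : MeasurableSet F) {τ : ℝ≥0∞} (h : ∀ x ∈ F, τ ≤ S E x) :
    τ * volume F ≤ calS n S E F := by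
  rw [calS, ← setLIntegral_const]
  exact setLIntegral_mono' hF h

lemma volume_pos_of_ofReal_le_calS {y : ℝ} (hy : 0 < y)
    (h : ENNReal.ofReal y ≤ calS n S E F) : 0 < volume F := by
  rw [pos_iff_ne_zero]
  intro h0
  rw [calS, setLIntegral_measure_zero F _ h0, nonpos_iff_eq_zero, ENNReal.ofReal_eq_zero] at h
  exact absurd h (not_le.2 hy)

/-- The superlevel set of `S E` at half its average over `F` carries half of `calS n S E F`. -/
lemma half_calS_le_calS_superlevel (hS : Measurable (S E))
    (hF₀ : volume F ≠ 0) (hF' : volume F ≠ ∞) (hfin : calS n S E F ≠ ∞) :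
    calS n S E F / 2 ≤
      calS n S E {x ∈ F | calS n S E F / (2 * volume F) ≤ S E x} := by
  have h := calS_le_calS_superlevel_add (F := F) hS (calS n S E F / (2 * volume F))
  rw [← ENNReal.mul_div_right_comm, ENNReal.mul_div_mul_right _ _ hF₀ hF'] at h
  refine (ENNReal.add_le_add_iff_right (ENNReal.div_ne_top hfin two_ne_zero)).1 ?_
  rwa [ENNReal.add_halves]

/-- Restricted strong type bound, in logarithmic form. -/
lemma LogHyp.log_le_of_ofReal_le_calS {r s δ K : ℝ} (H : LogHyp n r s δ K S)
    (hS : Measurable (S E)) (mE : MeasurableSet E) (hE : 0 < volume E) (hE' : volume E < ∞)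
    (mF : MeasurableSet F) (hF' : volume F < ∞) {y : ℝ} (hy : 0 < y)
    (h : ENNReal.ofReal (y * volume.real E ^ (1 / r)) ≤ calS n S E F) :
    s * Real.log (y / 2) - (s - 1) * Real.log (volume.real F) ≤ K := by
  have pe : 0 < volume.real E := ENNReal.toReal_pos hE.ne' hE'.ne
  have hpos : 0 < volume F := volume_pos_of_ofReal_le_calS (by positivity) h
  have pf : 0 < volume.real F := ENNReal.toReal_pos hpos.ne' hF'.ne
  set a : ℝ := y / 2 / volume.real F with ha
  set τ : ℝ≥0∞ := ENNReal.ofReal (a * volume.real E ^ (1 / r)) with hτ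
  set G : Set (EuclideanSpace ℝ (Fin n)) := {x ∈ F | τ ≤ S E x} with hG
  have mG : MeasurableSet G := mF.inter (measurableSet_le measurable_const hS)
  have hτF : τ * volume F = ENNReal.ofReal (y / 2 * volume.real E ^ (1 / r)) := by
    rw [hτ, ← ENNReal.ofReal_toReal hF'.ne, ← ENNReal.ofReal_mul (by positivity)]
    congr 1
    change a * volume.real E ^ (1 / r) * volume.real F = _
    rw [ha]; field_simp
  have hGS : ENNReal.ofReal (y / 2 * volume.real E ^ (1 / r)) ≤ calS n S E G := by
    have h₂ := h.trans (calS_le_calS_superlevel_add hS τ)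
    rw [hτF, show y * volume.real E ^ (1 / r) = y / 2 * volume.real E ^ (1 / r)
      + y / 2 * volume.real E ^ (1 / r) by ring,
      ENNReal.ofReal_add (by positivity) (by positivity)] at h₂
    exact (ENNReal.add_le_add_iff_right ENNReal.ofReal_ne_top).1 h₂
  have := H E E G mE mE mG hE hE' hE hE' (volume_pos_of_ofReal_le_calS (by positivity) hGS)
    ((measure_mono (sep_subset _ _)).trans_lt hF') le_rfl a (y / 2) (by positivity)
    (by positivity) (fun x hx => hx.2) (fun x hx => hx.2) hGS hGS
  rw [ha, Real.log_div (by positivity) pf.ne'] at this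
  linarith

end Superlevel

/-- Second moment bound: the square of the total measure of finitely many subsets of `F` is
at most `μ F` times the total measure of their pairwise intersections. -/
lemma sq_sum_measureReal_le {Ω ι : Type*} [MeasurableSpace Ω] (μ : Measure Ω) {F : Set Ω}
    (hF : μ F ≠ ∞) (J : Finset ι) (G : ι → Set Ω)
    (mG : ∀ j ∈ J, MeasurableSet (G j)) (hG : ∀ j ∈ J, G j ⊆ F) :
    (∑ j ∈ J, μ.real (G j)) ^ 2 ≤
      μ.real F * ∑ j ∈ J, ∑ k ∈ J, μ.real (G j ∩ G k) := by
  set ν := μ.restrict F with hν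
  have : IsFiniteMeasure ν := ⟨by simpa [hν] using hF.lt_top⟩
  have hint : ∀ A : Set Ω, MeasurableSet A →
      Integrable (A.indicator (fun _ => (1 : ℝ))) ν := fun A mA =>
    (integrable_const 1).indicator mA
  have hA : ∀ A : Set Ω, MeasurableSet A → A ⊆ F →
      ∫ x, A.indicator (fun _ => (1 : ℝ)) x ∂ν = μ.real A := by
    intro A mA hA
    rw [integral_indicator_const _ mA, hν, measureReal_restrict_apply mA, inter_eq_left.2 hA,
      smul_eq_mul, mul_one]
  set φ : Ω → ℝ := fun x => ∑ j ∈ J, (G j).indicator (fun _ => (1 : ℝ)) x with hφ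
  have hφint : Integrable φ ν := integrable_finsetSum _ fun j hj => hint _ (mG j hj)
  have h1 : ∫ x, φ x ∂ν = ∑ j ∈ J, μ.real (G j) := by
    rw [integral_finsetSum _ fun j hj => hint _ (mG j hj)]
    exact Finset.sum_congr rfl fun j hj => hA _ (mG j hj) (hG j hj)
  have hsq : ∀ x, φ x ^ 2 =
      ∑ j ∈ J, ∑ k ∈ J, (G j ∩ G k).indicator (fun _ => (1 : ℝ)) x := by
    intro x
    rw [sq, hφ, Finset.sum_mul_sum]
    refine Finset.sum_congr rfl fun j _ => Finset.sum_congr rfl fun k _ => ?_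
    by_cases h₁ : x ∈ G j <;> by_cases h₂ : x ∈ G k <;> simp [h₁, h₂]
  have hintjk : ∀ j ∈ J, ∀ k ∈ J,
      Integrable ((G j ∩ G k).indicator (fun _ => (1 : ℝ))) ν := fun j hj k hk =>
    hint _ ((mG j hj).inter (mG k hk))
  have hφ2int : Integrable (fun x => φ x ^ 2) ν := by
    simp_rw [hsq]
    exact integrable_finsetSum _ fun j hj => integrable_finsetSum _ (hintjk j hj)
  have h2 : ∫ x, φ x ^ 2 ∂ν = ∑ j ∈ J, ∑ k ∈ J, μ.real (G j ∩ G k) := by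
    simp_rw [hsq]
    rw [integral_finsetSum _ fun j hj => integrable_finsetSum _ (hintjk j hj)]
    refine Finset.sum_congr rfl fun j hj => ?_
    rw [integral_finsetSum _ (hintjk j hj)]
    exact Finset.sum_congr rfl fun k hk =>
      hA _ ((mG j hj).inter (mG k hk)) (inter_subset_left.trans (hG j hj))
  have hF1 : ν.real univ = μ.real F := by simp [hν]
  have hvar : ∀ m : ℝ, 0 ≤ ∫ x, φ x ^ 2 ∂ν - 2 * m * ∫ x, φ x ∂ν + m ^ 2 * μ.real F := by
    intro m
    have h0 : 0 ≤ ∫ x, (φ x ^ 2 - 2 * m * φ x + m ^ 2) ∂ν :=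
      integral_nonneg fun x => by
        change 0 ≤ φ x ^ 2 - 2 * m * φ x + m ^ 2
        nlinarith [sq_nonneg (φ x - m)]
    have hφm : Integrable (fun x => 2 * m * φ x) ν := hφint.const_mul _
    have hsub : Integrable (fun x => φ x ^ 2 - 2 * m * φ x) ν := hφ2int.sub hφm
    rw [integral_add hsub (integrable_const _), integral_sub hφ2int hφm,
      integral_const_mul, integral_const, hF1, smul_eq_mul] at h0
    linarith
  rw [h1, h2] at hvar
  rcases (measureReal_nonneg (μ := μ) (s := F)).eq_or_lt with h0 | hpos
  · have : ∑ j ∈ J, μ.real (G j) = 0 := Finset.sum_eq_zero fun j hj =>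
      le_antisymm ((measureReal_mono (hG j hj) hF).trans_eq h0.symm) measureReal_nonneg
    rw [this, ← h0]; simp
  · set σ := ∑ j ∈ J, μ.real (G j)
    have := mul_nonneg hpos.le (hvar (σ / μ.real F))
    have e : μ.real F * (∑ j ∈ J, ∑ k ∈ J, μ.real (G j ∩ G k) - 2 * (σ / μ.real F) * σ
        + (σ / μ.real F) ^ 2 * μ.real F)
        = μ.real F * (∑ j ∈ J, ∑ k ∈ J, μ.real (G j ∩ G k)) - σ ^ 2 := by
      field_simp; ring
    linarith

lemma exists_sum_exp_neg_abs_sub_le {κ : ℝ} (hκ : 0 < κ) :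
    ∃ M : ℝ, 0 ≤ M ∧ ∀ (J : Finset ℤ) (j : ℤ),
      ∑ k ∈ J, Real.exp (-κ * |(j : ℝ) - k|) ≤ M := by
  have hnat : Summable fun m : ℕ => Real.exp (-κ * m) := by
    have := Real.summable_exp_nat_mul_iff.2 (neg_lt_zero.2 hκ)
    simpa [mul_comm] using this
  have hsum : Summable fun m : ℤ => Real.exp (-κ * |(m : ℝ)|) :=
    Summable.of_nat_of_neg (by simpa using hnat) (by simpa using hnat)
  refine ⟨∑' m : ℤ, Real.exp (-κ * |(m : ℝ)|), tsum_nonneg fun _ => (Real.exp_pos _).le, ?_⟩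
  intro J j
  have hinj : Function.Injective fun k : ℤ => j - k := sub_right_injective
  have h := hsum.sum_le_tsum (J.map ⟨_, hinj⟩) fun _ _ => (Real.exp_pos _).le
  simpa using h

/-- If the pairwise intersections of subsets of `F` decay exponentially relative to each of them,
then their total measure is at most a constant times the measure of `F`. -/
lemma sum_measureReal_le_of_inter_le {Ω : Type*} [MeasurableSpace Ω] (μ : Measure Ω)
    {F : Set Ω} (hF : μ F ≠ ∞) (J : Finset ℤ) (G : ℤ → Set Ω)
    (mG : ∀ j ∈ J, MeasurableSet (G j)) (hG : ∀ j ∈ J, G j ⊆ F)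
    {κ M B : ℝ} (hB : 0 ≤ B) (hM₀ : 0 ≤ M)
    (hM : ∀ j : ℤ, ∑ k ∈ J, Real.exp (-κ * |(j : ℝ) - k|) ≤ M)
    (h : ∀ j ∈ J, ∀ k ∈ J, j ≠ k →
      μ.real (G j ∩ G k) ≤ B * μ.real (G j) * Real.exp (-κ * |(j : ℝ) - k|)) :
    ∑ j ∈ J, μ.real (G j) ≤ (1 + B * M) * μ.real F := by
  set σ := ∑ j ∈ J, μ.real (G j) with hσ
  have hσ₀ : 0 ≤ σ := Finset.sum_nonneg fun _ _ => measureReal_nonneg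
  have hrow : ∀ j ∈ J, ∑ k ∈ J, μ.real (G j ∩ G k) ≤ (1 + B * M) * μ.real (G j) := by
    intro j hj
    have hnn : 0 ≤ B * μ.real (G j) := by positivity
    rw [← Finset.add_sum_erase _ _ hj, inter_self]
    have : ∑ k ∈ J.erase j, μ.real (G j ∩ G k) ≤ B * μ.real (G j) * M :=
      calc ∑ k ∈ J.erase j, μ.real (G j ∩ G k)
          ≤ ∑ k ∈ J.erase j, B * μ.real (G j) * Real.exp (-κ * |(j : ℝ) - k|) :=
            Finset.sum_le_sum fun k hk =>
              h j hj k (Finset.mem_of_mem_erase hk) (Finset.ne_of_mem_erase hk).symm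
        _ ≤ ∑ k ∈ J, B * μ.real (G j) * Real.exp (-κ * |(j : ℝ) - k|) :=
            Finset.sum_le_sum_of_subset_of_nonneg (Finset.erase_subset _ _)
              fun _ _ _ => by positivity
        _ = B * μ.real (G j) * ∑ k ∈ J, Real.exp (-κ * |(j : ℝ) - k|) :=
            (Finset.mul_sum _ _ _).symm
        _ ≤ B * μ.real (G j) * M := mul_le_mul_of_nonneg_left (hM j) hnn
    linarith
  have hsq := (sq_sum_measureReal_le μ hF J G mG hG).trans
    (mul_le_mul_of_nonneg_left (Finset.sum_le_sum hrow) measureReal_nonneg)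
  rw [← Finset.mul_sum, ← hσ] at hsq
  rcases hσ₀.eq_or_lt with h0 | hpos
  · rw [← h0]; positivity
  · exact le_of_mul_le_mul_right (by nlinarith) hpos


/-- under Hypothesis 1, for a `A(1 + log(1/ε))`-separated family of
`ε`-quasi-extremal sets `E_j` (for a fixed `F`) at a common dyadic scale `η`, the sets
`G_j = {x ∈ F : S(1_{E_j})(x) ≥ 𝒮(E_j,F)/(2|F|)}` have total measure `≲ |F|`. -/
theorem quasi_extremal_almost_disjointness (n : ℕ) (hn : 1 ≤ n) (r s : ℝ)
    (hr : 1 < r) (hrs : r < s)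
    (S : Set (EuclideanSpace ℝ (Fin n)) → EuclideanSpace ℝ (Fin n) → ℝ≥0∞)
    (hSmeas : ∀ E : Set (EuclideanSpace ℝ (Fin n)), MeasurableSet E → Measurable (S E))
    (h1 : Hyp1 n r s S) :
    ∃ A C : ℝ, 1 ≤ A ∧ 0 < C ∧
      ∀ (F : Set (EuclideanSpace ℝ (Fin n))), MeasurableSet F →
        0 < volume F → volume F < ∞ →
      ∀ ε η : ℝ, 0 < ε → ε ≤ 1 → 0 < η → η ≤ 1 →
      ∀ (J : Finset ℤ), (∀ j ∈ J, ∀ k ∈ J, j ≠ k →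
        A * (1 + Real.log (1 / ε)) ≤ |((j : ℝ) - (k : ℝ))|) →
      ∀ E : ℤ → Set (EuclideanSpace ℝ (Fin n)),
        (∀ j ∈ J, MeasurableSet (E j)) →
        (∀ j ∈ J, 0 < volume (E j)) → (∀ j ∈ J, volume (E j) < ∞) →
        (∀ j ∈ J,
          ENNReal.ofReal (ε / 2) * volume (E j) ^ (1 / r) * volume F ^ (1 - 1 / s) <
            calS n S (E j) F ∧
          calS n S (E j) F ≤
            ENNReal.ofReal ε * volume (E j) ^ (1 / r) * volume F ^ (1 - 1 / s)) →
        (∀ j ∈ J,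
          ENNReal.ofReal (η / 2) < ((2 : ℝ≥0∞) ^ j) ^ r * volume (E j) ∧
            ((2 : ℝ≥0∞) ^ j) ^ r * volume (E j) ≤ ENNReal.ofReal η) →
        ∑ j ∈ J, volume {x ∈ F | calS n S (E j) F / (2 * volume F) ≤ S (E j) x} ≤
          ENNReal.ofReal C * volume F := by
  obtain ⟨δ, K, hδ, H⟩ := h1.exists_logHyp hr hrs
  have hs : 0 < s - 1 := by linarith
  have hs₀ : s ≠ 0 := by linarith
  have hr₀ : 0 < r := by linarith
  have hlog2 : 0 < Real.log 2 := Real.log_pos one_lt_two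
  set κ : ℝ := δ * r * Real.log 2 / 2 with hκ
  have hκ₀ : 0 < κ := by positivity
  obtain ⟨M, hM₀, hM⟩ := exists_sum_exp_neg_abs_sub_le hκ₀
  set K₁ : ℝ := K + s * Real.log 4 + δ * Real.log 2 with hK₁
  set K₂ : ℝ := (s * Real.log 8 + K) / (s - 1) with hK₂
  set t : ℝ := s / (s - 1) with ht
  have ht₀ : 0 < t := div_pos (by linarith) hs
  refine ⟨max 1 ((s + t) / κ), 1 + Real.exp (K₁ + K₂) * M, le_max_left _ _, by positivity, ?_⟩
  intro F mF hF hF' ε η hε hε₁ hη _ J hJ E mE hE hE' hS hEη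
  set f := volume.real F with hf
  have pf : 0 < f := ENNReal.toReal_pos hF.ne' hF'.ne
  set L : ℝ := Real.log (1 / ε) with hL
  have hL₀ : 0 ≤ L := Real.log_nonneg ((one_le_div hε).2 hε₁)
  have hlogε : Real.log ε = -L := by rw [hL, one_div, Real.log_inv, neg_neg]
  set G : ℤ → Set (EuclideanSpace ℝ (Fin n)) :=
    fun j => {x ∈ F | calS n S (E j) F / (2 * volume F) ≤ S (E j) x} with hG
  have mG : ∀ j ∈ J, MeasurableSet (G j) := fun j hj =>
    mF.inter (measurableSet_le measurable_const (hSmeas _ (mE j hj)))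
  have hGF : ∀ j ∈ J, G j ⊆ F := fun j _ => sep_subset _ _
  have hGfin : ∀ j ∈ J, volume (G j) < ∞ := fun j hj => (measure_mono (hGF j hj)).trans_lt hF'
  have pe : ∀ j ∈ J, 0 < volume.real (E j) := fun j hj =>
    ENNReal.toReal_pos (hE j hj).ne' (hE' j hj).ne
  have hlow : ∀ j ∈ J, ENNReal.ofReal
      (ε / 2 * f ^ (1 - 1 / s) * volume.real (E j) ^ (1 / r)) ≤ calS n S (E j) F := by
    intro j hj
    have pej := pe j hj
    refine Eq.trans_le ?_ (hS j hj).1.le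
    rw [rpow_eq_ofReal_toReal_rpow (hE j hj) (hE' j hj), rpow_eq_ofReal_toReal_rpow hF hF',
      ← ENNReal.ofReal_mul (by positivity),
      ← ENNReal.ofReal_mul (mul_nonneg (by positivity) (by positivity))]
    congr 1
    simp only [hf, measureReal_def]
    ring
  have hfin : ∀ j ∈ J, calS n S (E j) F ≠ ∞ := by
    intro j hj
    refine ((hS j hj).2.trans_lt ?_).ne
    rw [rpow_eq_ofReal_toReal_rpow (hE j hj) (hE' j hj), rpow_eq_ofReal_toReal_rpow hF hF']
    exact ENNReal.mul_lt_top (ENNReal.mul_lt_top ENNReal.ofReal_lt_top ENNReal.ofReal_lt_top)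
      ENNReal.ofReal_lt_top
  have hmass : ∀ j ∈ J, ENNReal.ofReal
      (ε / 4 * f ^ (1 - 1 / s) * volume.real (E j) ^ (1 / r)) ≤ calS n S (E j) (G j) := by
    intro j hj
    refine le_trans ?_ (half_calS_le_calS_superlevel (hSmeas _ (mE j hj)) hF.ne' hF'.ne
      (hfin j hj))
    refine le_trans (le_of_eq ?_) (ENNReal.div_le_div_right (hlow j hj) 2)
    rw [show ε / 4 * f ^ (1 - 1 / s) * volume.real (E j) ^ (1 / r) =
        ε / 2 * f ^ (1 - 1 / s) * volume.real (E j) ^ (1 / r) / 2 by ring,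
      ENNReal.ofReal_div_of_pos two_pos, ENNReal.ofReal_ofNat]
  have hlevel : ∀ j ∈ J, ∀ x ∈ G j,
      ENNReal.ofReal (ε / 4 * f ^ (-(1 / s)) * volume.real (E j) ^ (1 / r)) ≤ S (E j) x := by
    intro j hj x hx
    refine le_trans (le_trans (le_of_eq ?_)
      (ENNReal.div_le_div_right (hlow j hj) (2 * volume F))) hx.2
    have hvF : 2 * volume F = ENNReal.ofReal (2 * f) := by
      rw [ENNReal.ofReal_mul two_pos.le, ENNReal.ofReal_ofNat, hf, measureReal_def,
        ENNReal.ofReal_toReal hF'.ne]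
    rw [hvF, ← ENNReal.ofReal_div_of_pos (by positivity)]
    congr 1
    rw [sub_eq_add_neg, Real.rpow_add pf, Real.rpow_one]
    field_simp
    ring
  have hGlow : ∀ j ∈ J, Real.exp (-t * L - K₂) * f ≤ volume.real (G j) := by
    intro j hj
    have pej := pe j hj
    have h := H.log_le_of_ofReal_le_calS (hSmeas _ (mE j hj)) (mE j hj) (hE j hj)
      (hE' j hj) (mG j hj) (hGfin j hj) (by positivity) (hmass j hj)
    have pg : 0 < volume.real (G j) := ENNReal.toReal_pos
      (volume_pos_of_ofReal_le_calS (by positivity) (hmass j hj)).ne' (hGfin j hj).ne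
    rw [show ε / 4 * f ^ (1 - 1 / s) / 2 = ε / 8 * f ^ (1 - 1 / s) by ring,
      Real.log_mul (by positivity) (by positivity), Real.log_rpow pf,
      Real.log_div hε.ne' (by norm_num), hlogε] at h
    rw [← Real.log_le_log_iff (by positivity) pg, Real.log_mul (by positivity) pf.ne',
      Real.log_exp]
    refine le_of_mul_le_mul_left ?_ hs
    have e₁ : (s - 1) * (-t * L - K₂ + Real.log f) =
        -s * L - s * Real.log 8 - K + (s - 1) * Real.log f := by
      rw [ht, hK₂]; field_simp; ring
    have e₂ : s * (-L - Real.log 8 + (1 - 1 / s) * Real.log f) =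
        -s * L - s * Real.log 8 + (s - 1) * Real.log f := by
      linear_combination (-Real.log f) * div_self hs₀
    linarith
  have hElog : ∀ j ∈ J,
      Real.log η - Real.log 2 ≤ j * r * Real.log 2 + Real.log (volume.real (E j)) ∧
        j * r * Real.log 2 + Real.log (volume.real (E j)) ≤ Real.log η := by
    intro j hj
    have pej := pe j hj
    have e : ((2 : ℝ≥0∞) ^ j) ^ r * volume (E j) =
        ENNReal.ofReal ((2 : ℝ) ^ ((j : ℝ) * r) * volume.real (E j)) := by
      rw [← ENNReal.rpow_intCast, ← ENNReal.rpow_mul, ENNReal.ofReal_mul (by positivity),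
        ← ENNReal.ofReal_rpow_of_pos two_pos, ENNReal.ofReal_ofNat, measureReal_def,
        ENNReal.ofReal_toReal (hE' j hj).ne]
    obtain ⟨h₁, h₂⟩ := hEη j hj
    rw [e] at h₁ h₂
    have h₁' := Real.log_le_log (by positivity)
      ((ENNReal.ofReal_le_ofReal_iff (by positivity)).1 h₁.le)
    have h₂' := Real.log_le_log (by positivity) ((ENNReal.ofReal_le_ofReal_iff hη.le).1 h₂)
    rw [Real.log_div hη.ne' two_ne_zero, Real.log_mul (by positivity) pej.ne',
      Real.log_rpow two_pos] at h₁'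
    rw [Real.log_mul (by positivity) pej.ne', Real.log_rpow two_pos] at h₂'
    exact ⟨h₁', h₂'⟩
  have hpair : ∀ j ∈ J, ∀ k ∈ J, volume (E j) ≤ volume (E k) → 0 < volume (G j ∩ G k) →
      Real.log (volume.real (G j ∩ G k)) ≤
        K₁ + s * L - δ * r * Real.log 2 * |(j : ℝ) - k| + Real.log f := by
    intro j hj k hk hjk hpos
    have hlt : volume (G j ∩ G k) < ∞ :=
      (measure_mono inter_subset_left).trans_lt (hGfin j hj)
    have pg : 0 < volume.real (G j ∩ G k) := ENNReal.toReal_pos hpos.ne' hlt.ne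
    have mI := (mG j hj).inter (mG k hk)
    have hα : 0 < ε / 4 * f ^ (-(1 / s)) := by positivity
    have hmul : ∀ i, (∀ x ∈ G j ∩ G k,
        ENNReal.ofReal (ε / 4 * f ^ (-(1 / s)) * volume.real (E i) ^ (1 / r)) ≤ S (E i) x) →
        ENNReal.ofReal (ε / 4 * f ^ (-(1 / s)) * volume.real (G j ∩ G k)
          * volume.real (E i) ^ (1 / r)) ≤ calS n S (E i) (G j ∩ G k) := by
      intro i hi
      refine Eq.trans_le ?_ (mul_volume_le_calS mI hi)
      rw [mul_right_comm, ENNReal.ofReal_mul (by positivity), measureReal_def (s := G j ∩ G k),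
        ENNReal.ofReal_toReal hlt.ne]
    have hj' := fun x (hx : x ∈ G j ∩ G k) => hlevel j hj x hx.1
    have hk' := fun x (hx : x ∈ G j ∩ G k) => hlevel k hk x hx.2
    have h := H (E j) (E k) (G j ∩ G k) (mE j hj) (mE k hk) mI (hE j hj) (hE' j hj) (hE k hk)
      (hE' k hk) hpos hlt hjk _ _ hα (mul_pos hα pg) hj' hk' (hmul j hj') (hmul k hk')
    rw [Real.log_mul hα.ne' pg.ne', Real.log_mul (by positivity) (by positivity),
      Real.log_rpow pf, Real.log_div hε.ne' (by norm_num), hlogε] at h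
    have hle : Real.log (volume.real (E j)) ≤ Real.log (volume.real (E k)) :=
      Real.log_le_log (pe j hj) (ENNReal.toReal_mono (hE' k hk).ne hjk)
    have hdist : r * Real.log 2 * |(j : ℝ) - k| - Real.log 2 ≤
        Real.log (volume.real (E k)) - Real.log (volume.real (E j)) := by
      obtain ⟨j₁, j₂⟩ := hElog j hj
      obtain ⟨k₁, k₂⟩ := hElog k hk
      rcases abs_cases ((j : ℝ) - k) with ⟨e, _⟩ | ⟨e, _⟩ <;> rw [e] <;> linarith
    have h₃ := mul_le_mul_of_nonneg_left hdist hδ.le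
    have e : s * (-L - Real.log 4 + -(1 / s) * Real.log f) =
        -s * L - s * Real.log 4 - Real.log f := by
      field_simp; ring
    rw [hK₁]
    linarith
  have hinter : ∀ j ∈ J, ∀ k ∈ J, j ≠ k →
      volume.real (G j ∩ G k) ≤
        Real.exp (K₁ + K₂) * volume.real (G j) * Real.exp (-κ * |(j : ℝ) - k|) := by
    intro j hj k hk hjk
    rcases (measureReal_nonneg (μ := volume) (s := G j ∩ G k)).eq_or_lt with h₀ | pg
    · rw [← h₀]; positivity
    have hpos : 0 < volume (G j ∩ G k) := (ENNReal.toReal_pos_iff.1 pg).1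
    have hlog : Real.log (volume.real (G j ∩ G k)) ≤
        K₁ + s * L - δ * r * Real.log 2 * |(j : ℝ) - k| + Real.log f := by
      rcases le_total (volume (E j)) (volume (E k)) with h | h
      · exact hpair j hj k hk h hpos
      · rw [inter_comm, abs_sub_comm]
        exact hpair k hk j hj h (by rwa [inter_comm])
    have hsep : (s + t) * L ≤ κ * |(j : ℝ) - k| := by
      have h₁ : (s + t) / κ * (1 + L) ≤ |(j : ℝ) - k| :=
        (mul_le_mul_of_nonneg_right (le_max_right _ _) (by linarith)).trans (hJ j hj k hk hjk)
      have h₂ := mul_le_mul_of_nonneg_left h₁ hκ₀.le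
      rw [← mul_assoc, mul_div_cancel₀ _ hκ₀.ne'] at h₂
      linarith
    calc volume.real (G j ∩ G k)
        ≤ Real.exp (K₁ + s * L - δ * r * Real.log 2 * |(j : ℝ) - k| + Real.log f) :=
          (Real.log_le_iff_le_exp pg).1 hlog
      _ ≤ Real.exp (K₁ + K₂ + (-t * L - K₂ + Real.log f) + -κ * |(j : ℝ) - k|) := by
          refine Real.exp_le_exp.2 ?_
          have : δ * r * Real.log 2 = 2 * κ := by rw [hκ]; ring
          rw [this]; linarith
      _ = Real.exp (K₁ + K₂) * (Real.exp (-t * L - K₂) * f) * Real.exp (-κ * |(j : ℝ) - k|) := by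
          rw [Real.exp_add, Real.exp_add (K₁ + K₂), Real.exp_add (-t * L - K₂), Real.exp_log pf]
      _ ≤ _ := by gcongr; exact hGlow j hj
  have hfinal := sum_measureReal_le_of_inter_le volume hF'.ne J G mG hGF (Real.exp_pos _).le hM₀
    (hM J) hinter
  calc ∑ j ∈ J, volume (G j) = ENNReal.ofReal (∑ j ∈ J, volume.real (G j)) := by
        rw [ENNReal.ofReal_sum_of_nonneg fun _ _ => measureReal_nonneg]
        exact Finset.sum_congr rfl fun j hj => (ENNReal.ofReal_toReal (hGfin j hj).ne).symm
    _ ≤ ENNReal.ofReal ((1 + Real.exp (K₁ + K₂) * M) * f) := ENNReal.ofReal_le_ofReal hfinal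
    _ = _ := by
        rw [ENNReal.ofReal_mul (by positivity), hf, measureReal_def,
          ENNReal.ofReal_toReal hF'.ne]
end
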